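/- Let F ∈ ℤ[x,y,z] be a non-singular homogeneous form of degree k ≥ 3, let 0 ≤ γ < k and τ = k−γ, and let ν = ν_F be the maximum order of contact of the curve C_F with a tangent line at an inflection point. Then there is a constant C = C(F,γ) such that for all B ≥ 1, the number of triples (x,y,z) ∈ ℤ³ with gcd(x,y,z) = 1, |F(x,y,z)| ≤ B^γ, B/2 < max(|x|,|y|,|z|) ≤ B, and whose coordinate vector lies on some tangent line of C_F at an inflection point, is at most C·B^{2−τ/ν}. -/

import Mathlib

open MvPolynomial

/-- The one-variable polynomial `t ↦ F(p + t v)` restricted to a line, over `ℂ`;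
its root multiplicity at `t = 0` is the order of contact of the line with `C_F` at `p`. -/
noncomputable def contactOrder (F : MvPolynomial (Fin 3) ℤ) (p v : Fin 3 → ℂ) : ℕ :=
  Polynomial.rootMultiplicity 0
    (MvPolynomial.aeval (fun i => Polynomial.C (p i) + Polynomial.C (v i) * Polynomial.X) F)

/-- `p` is an inflection point of `C_F` with tangent direction `v`. -/
def IsInflTangent (F : MvPolynomial (Fin 3) ℤ) (p v : Fin 3 → ℂ) : Prop :=
  p ≠ 0 ∧ MvPolynomial.aeval p F = 0 ∧ (∀ c : ℂ, v ≠ c • p) ∧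
    (∑ i, v i * MvPolynomial.aeval p (MvPolynomial.pderiv i F)) = 0 ∧
    3 ≤ contactOrder F p v

/-- The integer point `x` lies on a tangent line of `C_F` at an inflection point,
viewed as a two-dimensional linear subspace of `ℂ³`. -/
def OnInflTangent (F : MvPolynomial (Fin 3) ℤ) (x : Fin 3 → ℤ) : Prop :=
  ∃ p v : Fin 3 → ℂ, IsInflTangent F p v ∧
    (fun i => (x i : ℂ)) ∈ Submodule.span ℂ ({p, v} : Set (Fin 3 → ℂ))

/-- `x` is a primitive triple counted by `N_γ(F,B)`. -/
def Counted (F : MvPolynomial (Fin 3) ℤ) (γ B : ℝ) (x : Fin 3 → ℤ) : Prop :=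
  Int.gcd (x 0) (Int.gcd (x 1) (x 2)) = 1 ∧
    ((|MvPolynomial.eval x F| : ℤ) : ℝ) ≤ B ^ γ ∧
    B / 2 < max |(x 0 : ℝ)| (max |(x 1 : ℝ)| |(x 2 : ℝ)|) ∧
    max |(x 0 : ℝ)| (max |(x 1 : ℝ)| |(x 2 : ℝ)|) ≤ B

section HasseDerivative

variable {σ : Type*} [Fintype σ] {R : Type*} [CommRing R]

/-- The Hasse derivative `(1 / J!) ∂^J` on multivariate polynomials. -/
noncomputable def hasse (R : Type*) [CommRing R] (J : σ →₀ ℕ) :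
    MvPolynomial σ R →ₗ[R] MvPolynomial σ R :=
  (basisMonomials σ R).constr R fun I => monomial (I - J) ((∏ i, (I i).choose (J i) : ℕ) : R)

theorem hasse_monomial (J I : σ →₀ ℕ) (a : R) :
    hasse R J (monomial I a) = monomial (I - J) (a * ((∏ i, (I i).choose (J i) : ℕ) : R)) := by
  have h : monomial I a = a • basisMonomials σ R I := by
    simp [smul_monomial]
  rw [h, map_smul, hasse, Module.Basis.constr_basis, smul_monomial, smul_eq_mul]

theorem prod_choose_eq_zero {I J : σ →₀ ℕ} (h : ¬ J ≤ I) :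
    ∏ i : σ, (I i).choose (J i) = 0 := by
  rw [Finsupp.le_def] at h
  push Not at h
  obtain ⟨i, hi⟩ := h
  exact Finset.prod_eq_zero (i := i) (Finset.mem_univ i) (Nat.choose_eq_zero_of_lt hi)

theorem hasse_zero (P : MvPolynomial σ R) : hasse R 0 P = P := by
  induction P using MvPolynomial.induction_on' with
  | monomial I a => simp [hasse_monomial]
  | add p q hp hq => rw [map_add, hp, hq]

theorem hasse_hasse (J K : σ →₀ ℕ) (P : MvPolynomial σ R) :
    hasse R K (hasse R J P) =
      ((∏ i, (J i + K i).choose (J i) : ℕ) : R) • hasse R (J + K) P := by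
  induction P using MvPolynomial.induction_on' with
  | monomial I a =>
    simp only [hasse_monomial, smul_monomial, smul_eq_mul]
    rw [tsub_tsub, mul_assoc, ← Nat.cast_mul, mul_left_comm, ← Nat.cast_mul,
      ← Finset.prod_mul_distrib,
      ← Finset.prod_mul_distrib]
    refine congrArg _ (congrArg (fun n : ℕ => a * (n : R)) (Finset.prod_congr rfl fun i _ => ?_))
    simp only [Finsupp.tsub_apply, Finsupp.add_apply]
    rcases le_or_gt (J i + K i) (I i) with h | h
    · have := Nat.choose_mul (n := I i) (k := J i + K i) (s := J i) (by omega)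
      rw [add_tsub_cancel_left] at this
      rw [← this, mul_comm]
    · rw [Nat.choose_eq_zero_of_lt h, mul_zero]
      rcases le_or_gt (J i) (I i) with h' | h'
      · rw [Nat.choose_eq_zero_of_lt (show I i - J i < K i by omega), mul_zero]
      · rw [Nat.choose_eq_zero_of_lt h', zero_mul]
  | add p q hp hq => simp only [map_add, hp, hq, smul_add]

theorem hasse_single_one [DecidableEq σ] (i : σ) (P : MvPolynomial σ R) :
    hasse R (Finsupp.single i 1) P = pderiv i P := by
  induction P using MvPolynomial.induction_on' with
  | monomial I a =>
    rw [hasse_monomial, pderiv_monomial]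
    congr 3
    rw [Finset.prod_eq_single i]
    · simp
    · intro j _ hj
      simp [hj.symm]
    · simp
  | add p q hp hq => rw [map_add, map_add, hp, hq]

/-- Translation of a polynomial by a point with coordinates in an algebra. -/
noncomputable def shift {A : Type*} [CommRing A] [Algebra R A] (x : σ → A) :
    MvPolynomial σ R →ₐ[R] MvPolynomial σ A :=
  aeval fun i => X i + C (x i)

theorem coeff_shift {A : Type*} [CommRing A] [Algebra R A] (x : σ → A) (J : σ →₀ ℕ)
    (P : MvPolynomial σ R) : coeff J (shift x P) = aeval x (hasse R J P) := by
  classical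
  induction P using MvPolynomial.induction_on' with
  | monomial I a =>
    rw [hasse_monomial, shift, aeval_monomial, aeval_monomial,
      Finsupp.prod_fintype _ _ (by simp), Finsupp.prod_fintype _ _ (by simp)]
    have h1 : ∀ i, (X i + C (x i)) ^ (I i) = ∑ j ∈ Finset.range (I i + 1),
        monomial (Finsupp.single i j) (x i ^ (I i - j) * ((I i).choose j : A)) := by
      intro i
      rw [add_pow]
      refine Finset.sum_congr rfl fun j _ => ?_
      rw [X_pow_eq_monomial, ← C_pow, mul_comm (monomial _ _), mul_assoc,
        ← map_natCast (C : A →+* MvPolynomial σ A), mul_comm (monomial _ _), ← mul_assoc, ← C_mul,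
        C_mul_monomial, mul_one]
    simp_rw [h1]
    rw [Finset.prod_univ_sum]
    have h2 : ∀ f : σ → ℕ, (∏ i, monomial (Finsupp.single i (f i))
        (x i ^ (I i - f i) * ((I i).choose (f i) : A))) =
        monomial (Finsupp.equivFunOnFinite.symm f)
          (∏ i, (x i ^ (I i - f i) * ((I i).choose (f i) : A))) := by
      intro f
      rw [← monomial_sum_prod]
      congr 2
      ext i
      simp [Finsupp.finsetSum_apply, Finsupp.single_apply]
    simp_rw [h2, IsScalarTower.algebraMap_apply R A (MvPolynomial σ A), algebraMap_eq]
    rw [coeff_C_mul, coeff_sum]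
    simp_rw [coeff_monomial]
    have h3 : ∀ f : σ → ℕ, Finsupp.equivFunOnFinite.symm f = J ↔ f = J := fun f => by
      rw [Equiv.symm_apply_eq]; rfl
    simp_rw [h3]
    rw [Finset.sum_ite_eq']
    simp only [Fintype.mem_piFinset, Finset.mem_range]
    split_ifs with h
    · rw [Finset.prod_mul_distrib, map_mul, mul_assoc, map_natCast, Nat.cast_prod,
        mul_comm (∏ i, x i ^ _)]
      rfl
    · rw [prod_choose_eq_zero]
      · simp
      · intro hle
        exact h fun i => Nat.lt_succ_of_le (hle i)
  | add p q hp hq => simp only [map_add, coeff_add, hp, hq]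

end HasseDerivative

section GeneralizedWronskian

theorem coeff_X_mul_pderiv {σ R : Type*} [CommRing R] (i : σ) (I : σ →₀ ℕ)
    (P : MvPolynomial σ R) : coeff I (X i * pderiv i P) = I i * coeff I P := by
  classical
  induction P using MvPolynomial.induction_on' with
  | monomial J a =>
    rw [pderiv_monomial, X, monomial_mul, coeff_monomial, coeff_monomial, one_mul]
    rcases Nat.eq_zero_or_pos (J i) with h | h
    · rw [h]
      split_ifs with h1 h2 h2 <;> simp_all
    · have : Finsupp.single i 1 + (J - Finsupp.single i 1) = J := by
        rw [add_comm]
        exact tsub_add_cancel_of_le (Finsupp.single_le_iff.mpr h)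
      rw [this]
      split_ifs with h1
      · rw [h1, mul_comm]
      · simp
  | add p q hp hq => rw [map_add, mul_add, coeff_add, hp, hq, coeff_add, mul_add]

theorem exists_C_mul_eq_C_mul {n : ℕ} {V N : MvPolynomial (Fin n) ℤ} (hV : V ≠ 0)
    (h : ∀ i, V * pderiv i N = N * pderiv i V) :
    ∃ a b : ℤ, b ≠ 0 ∧ C b * N = C a * V := by
  let m : MonomialOrder (Fin n) := MonomialOrder.lex
  set A := m.degree V
  refine ⟨coeff A N, coeff A V, m.leadingCoeff_ne_zero_iff.mpr hV, ?_⟩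
  rw [← sub_eq_zero]
  set N' := C (coeff A V) * N - C (coeff A N) * V with hN'
  by_contra hne
  have h' : ∀ i, V * (X i * pderiv i N') = N' * (X i * pderiv i V) := by
    intro i
    have : pderiv i N' = C (coeff A V) * pderiv i N - C (coeff A N) * pderiv i V := by
      simp [hN']
    rw [this, hN']
    linear_combination (X i * C (coeff A V)) * h i
  have hdeg : ∀ (P : MvPolynomial (Fin n) ℤ) (i), m.toSyn (m.degree (X i * pderiv i P)) ≤
      m.toSyn (m.degree P) := by
    intro P i
    rw [m.degree_le_iff]
    intro c hc
    apply m.le_degree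
    rw [mem_support_iff, coeff_X_mul_pderiv] at hc
    rw [mem_support_iff]
    exact right_ne_zero_of_mul hc
  have key : m.degree N' = A := by
    ext i
    have h1 := congrArg (coeff (A + m.degree N')) (h' i)
    rw [m.coeff_mul_of_add_of_degree_le le_rfl (hdeg _ _), add_comm,
      m.coeff_mul_of_add_of_degree_le le_rfl (hdeg _ _), coeff_X_mul_pderiv,
      coeff_X_mul_pderiv] at h1
    have h2 : coeff A V ≠ 0 := m.leadingCoeff_ne_zero_iff.mpr hV
    have h3 : coeff (m.degree N') N' ≠ 0 := m.leadingCoeff_ne_zero_iff.mpr hne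
    have h4 : coeff A V * coeff (m.degree N') N' * ((m.degree N' i : ℤ) - A i) = 0 := by
      linear_combination h1
    have := (mul_eq_zero.mp h4).resolve_left (mul_ne_zero h2 h3)
    omega
  have h3 : coeff (m.degree N') N' ≠ 0 := m.leadingCoeff_ne_zero_iff.mpr hne
  rw [key, hN', coeff_sub, coeff_C_mul, coeff_C_mul] at h3
  exact h3 (by ring)

/-- Linearly independent polynomials have a non-vanishing generalized Wronskian. -/
theorem exists_hasse_det_ne_zero {n k : ℕ} (φ : Fin k → MvPolynomial (Fin n) ℤ)
    (hφ : LinearIndependent ℤ φ) :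
    ∃ J : Fin k → (Fin n →₀ ℕ), (∀ i, (J i).degree ≤ i) ∧
      (Matrix.of fun i j => hasse ℤ (J i) (φ j)).det ≠ 0 := by
  induction k with
  | zero => exact ⟨Fin.elim0, fun i => i.elim0, by simp⟩
  | succ k ih =>
    obtain ⟨J, hJ, hdet⟩ := ih (φ ∘ Fin.castSucc) (hφ.comp _ (Fin.castSucc_injective k))
    by_contra! hcon
    let c : Fin (k + 1) → MvPolynomial (Fin n) ℤ := fun j =>
      (-1) ^ (k + j : ℕ) * (Matrix.of fun a b => hasse ℤ (J a) (φ (j.succAbove b))).det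
    have hR : ∀ K : Fin n →₀ ℕ, K.degree ≤ k → ∑ j, c j * hasse ℤ K (φ j) = 0 := by
      intro K hK
      have h := hcon (Fin.snoc J K) (fun i => by
        refine Fin.lastCases ?_ (fun i => ?_) i
        · simpa using hK
        · simpa using hJ i)
      rw [Matrix.det_succ_row _ (Fin.last k)] at h
      rw [← h]
      refine Finset.sum_congr rfl fun j _ => ?_
      simp only [c, Matrix.of_apply, Fin.snoc_last, Fin.val_last, Fin.succAbove_last]
      rw [mul_right_comm]
      congr 3
      ext a b
      simp
    have hV : c (Fin.last k) ≠ 0 := by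
      simp only [c, Fin.succAbove_last]
      refine mul_ne_zero (pow_ne_zero _ (by simp)) hdet
    have hR' : ∀ (h : Fin n) (K : Fin n →₀ ℕ), K.degree < k →
        ∑ j, pderiv h (c j) * hasse ℤ K (φ j) = 0 := by
      intro h K hK
      have h1 := congrArg (pderiv h) (hR K hK.le)
      rw [map_sum, map_zero] at h1
      simp_rw [Derivation.leibniz, smul_eq_mul] at h1
      rw [Finset.sum_add_distrib] at h1
      have h2 : ∑ j, c j * pderiv h (hasse ℤ K (φ j)) = 0 := by
        simp_rw [← hasse_single_one, hasse_hasse, mul_smul_comm, ← Finset.smul_sum]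
        rw [hR _ (by simpa using hK), smul_zero]
      rw [h2, zero_add] at h1
      rw [← h1]
      exact Finset.sum_congr rfl fun j _ => mul_comm _ _
    have hd : ∀ (h : Fin n) (j : Fin k), c (Fin.last k) * pderiv h (c j.castSucc) =
        c j.castSucc * pderiv h (c (Fin.last k)) := by
      intro h
      let d : Fin (k + 1) → MvPolynomial (Fin n) ℤ := fun j =>
        c (Fin.last k) * pderiv h (c j) - c j * pderiv h (c (Fin.last k))
      have h0 := Matrix.eq_zero_of_mulVec_eq_zero (v := d ∘ Fin.castSucc) hdet (by
        ext1 a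
        have h1 : ∑ j, d j * hasse ℤ (J a) (φ j) = 0 := by
          simp only [d, sub_mul, Finset.sum_sub_distrib]
          have e1 := hR (J a) ((hJ a).trans a.2.le)
          have e2 := hR' h (J a) ((hJ a).trans_lt a.2)
          simp_rw [mul_assoc, mul_comm (pderiv h (c (Fin.last k))), ← mul_assoc]
          rw [← Finset.sum_mul, e1]
          simp_rw [mul_assoc]
          rw [← Finset.mul_sum, e2]
          simp
        rw [Fin.sum_univ_castSucc] at h1
        have h2 : d (Fin.last k) = 0 := sub_eq_zero.mpr rfl
        rw [h2, zero_mul, add_zero] at h1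
        simp only [Matrix.mulVec, dotProduct, Matrix.of_apply, Function.comp_apply, Pi.zero_apply]
        rw [← h1]
        exact Finset.sum_congr rfl fun j _ => mul_comm _ _)
      intro j
      exact sub_eq_zero.mp (congrFun h0 j)
    have hconst : ∀ j, ∃ a b : ℤ, b ≠ 0 ∧ C b * c j = C a * c (Fin.last k) := by
      intro j
      refine Fin.lastCases ⟨1, 1, one_ne_zero, rfl⟩ (fun j => ?_) j
      exact exists_C_mul_eq_C_mul hV fun i => hd i j
    choose a b hb hab using hconst
    have hsum := hR 0 (by simp)
    simp_rw [hasse_zero] at hsum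
    have h1 : ∑ j, (a j * ∏ i ∈ Finset.univ.erase j, b i) • φ j = 0 := by
      have : c (Fin.last k) * ∑ j, (a j * ∏ i ∈ Finset.univ.erase j, b i) • φ j = 0 := by
        rw [Finset.mul_sum]
        have e : C (∏ i, b i) * ∑ j, c j * φ j = 0 := by rw [hsum, mul_zero]
        rw [← e, Finset.mul_sum]
        refine Finset.sum_congr rfl fun j _ => ?_
        rw [← Finset.mul_prod_erase _ _ (Finset.mem_univ j), smul_eq_C_mul, C_mul, C_mul]
        linear_combination (-(C (∏ i ∈ Finset.univ.erase j, b i) * φ j)) * hab j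
      exact (mul_eq_zero.mp this).resolve_left hV
    have h2 := Fintype.linearIndependent_iff.mp hφ _ h1 (Fin.last k)
    have h3 : a (Fin.last k) ≠ 0 := by
      intro h0
      have := hab (Fin.last k)
      rw [h0, C_0, zero_mul] at this
      exact (mul_ne_zero (by simpa using hb (Fin.last k)) hV) this
    exact mul_ne_zero h3 (Finset.prod_ne_zero_iff.mpr fun i _ => hb i) h2

end GeneralizedWronskian

section Length

variable {σ : Type*}

/-- The length of an integer polynomial: the sum of the absolute values of its coefficients. -/
noncomputable def len (P : MvPolynomial σ ℤ) : ℝ := ∑ I ∈ P.support, |((coeff I P : ℤ) : ℝ)|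

theorem len_eq_sum {P : MvPolynomial σ ℤ} {s : Finset (σ →₀ ℕ)} (h : P.support ⊆ s) :
    len P = ∑ I ∈ s, |((coeff I P : ℤ) : ℝ)| :=
  Finset.sum_subset h fun I _ hI => by simp [notMem_support_iff.mp hI]

theorem len_nonneg (P : MvPolynomial σ ℤ) : 0 ≤ len P :=
  Finset.sum_nonneg fun _ _ => abs_nonneg _

@[simp]
theorem len_zero : len (0 : MvPolynomial σ ℤ) = 0 := by simp [len]

theorem abs_coeff_le_len (P : MvPolynomial σ ℤ) (I : σ →₀ ℕ) : |((coeff I P : ℤ) : ℝ)| ≤ len P := by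
  by_cases h : I ∈ P.support
  · exact Finset.single_le_sum (f := fun I => |((coeff I P : ℤ) : ℝ)|) (fun _ _ => abs_nonneg _) h
  · simp [notMem_support_iff.mp h, len_nonneg]

theorem len_monomial (I : σ →₀ ℕ) (a : ℤ) : len (monomial I a) = |(a : ℝ)| := by
  classical
  rw [len_eq_sum support_monomial_subset, Finset.sum_singleton, coeff_monomial, if_pos rfl]

theorem len_add_le (P Q : MvPolynomial σ ℤ) : len (P + Q) ≤ len P + len Q := by
  classical
  rw [len_eq_sum (s := P.support ∪ Q.support) support_add,
    len_eq_sum (P := P) (s := P.support ∪ Q.support) Finset.subset_union_left,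
    len_eq_sum (P := Q) (s := P.support ∪ Q.support) Finset.subset_union_right,
    ← Finset.sum_add_distrib]
  refine Finset.sum_le_sum fun I _ => ?_
  rw [coeff_add, Int.cast_add]
  exact abs_add_le _ _

theorem len_sum_le {ι : Type*} (s : Finset ι) (P : ι → MvPolynomial σ ℤ) :
    len (∑ i ∈ s, P i) ≤ ∑ i ∈ s, len (P i) := by
  classical
  induction s using Finset.induction_on with
  | empty => simp
  | insert i s hi ih =>
    rw [Finset.sum_insert hi, Finset.sum_insert hi]
    exact (len_add_le _ _).trans (by gcongr)

theorem len_mul_le (P Q : MvPolynomial σ ℤ) : len (P * Q) ≤ len P * len Q := by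
  conv_lhs => rw [P.as_sum, Q.as_sum, Finset.sum_mul_sum]
  refine (len_sum_le _ _).trans ?_
  rw [len, len, Finset.sum_mul_sum]
  refine Finset.sum_le_sum fun I _ => (len_sum_le _ _).trans ?_
  refine Finset.sum_le_sum fun J _ => ?_
  rw [monomial_mul, len_monomial, Int.cast_mul, abs_mul]

theorem len_neg (P : MvPolynomial σ ℤ) : len (-P) = len P := by
  simp [len]

theorem len_prod_le {ι : Type*} (s : Finset ι) (P : ι → MvPolynomial σ ℤ) :
    len (∏ i ∈ s, P i) ≤ ∏ i ∈ s, len (P i) := by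
  classical
  induction s using Finset.induction_on with
  | empty =>
    rw [Finset.prod_empty, Finset.prod_empty, ← C_1, C_apply, len_monomial]
    simp
  | insert i s hi ih =>
    rw [Finset.prod_insert hi, Finset.prod_insert hi]
    exact (len_mul_le _ _).trans (mul_le_mul_of_nonneg_left ih (len_nonneg _))

theorem len_det_le {k : ℕ} (A : Matrix (Fin k) (Fin k) (MvPolynomial σ ℤ)) {L : ℝ}
    (h : ∀ i j, len (A i j) ≤ L) : len A.det ≤ k.factorial * L ^ k := by
  rw [Matrix.det_apply]
  refine (len_sum_le _ _).trans ?_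
  have : ∀ s ∈ (Finset.univ : Finset (Equiv.Perm (Fin k))),
      len (Equiv.Perm.sign s • ∏ i, A (s i) i) ≤ L ^ k := by
    intro s _
    have h1 : len (Equiv.Perm.sign s • ∏ i, A (s i) i) = len (∏ i, A (s i) i) := by
      rcases Int.units_eq_one_or (Equiv.Perm.sign s) with h | h <;> rw [h]
      · rw [one_smul]
      · rw [Units.neg_smul, one_smul, len_neg]
    rw [h1]
    refine (len_prod_le _ _).trans ?_
    refine (Finset.prod_le_prod (fun i _ => len_nonneg _) fun i _ => h _ _).trans ?_
    simp
  refine (Finset.sum_le_sum this).trans ?_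
  simp [Fintype.card_perm]

theorem degreeOf_det_le {k : ℕ} (A : Matrix (Fin k) (Fin k) (MvPolynomial σ ℤ)) {d : ℕ} {i : σ}
    (h : ∀ a b, degreeOf i (A a b) ≤ d) : degreeOf i A.det ≤ k * d := by
  rw [Matrix.det_apply]
  refine (degreeOf_sum_le _ _ _).trans (Finset.sup_le fun s _ => ?_)
  have h1 : degreeOf i (Equiv.Perm.sign s • ∏ i, A (s i) i) = degreeOf i (∏ i, A (s i) i) := by
    rcases Int.units_eq_one_or (Equiv.Perm.sign s) with h | h <;> rw [h]
    · rw [one_smul]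
    · rw [Units.neg_smul, one_smul, degreeOf_neg]
  rw [h1]
  refine (degreeOf_prod_le _ _ _).trans ((Finset.sum_le_sum fun a _ => h _ _).trans ?_)
  simp

variable [Fintype σ]

theorem hasse_eq_sum (J : σ →₀ ℕ) (P : MvPolynomial σ ℤ) :
    hasse ℤ J P = ∑ I ∈ P.support,
      monomial (I - J) (coeff I P * ((∏ i, (I i).choose (J i) : ℕ) : ℤ)) := by
  conv_lhs => rw [P.as_sum, map_sum]
  simp_rw [hasse_monomial]

theorem len_hasse_le (J : σ →₀ ℕ) {P : MvPolynomial σ ℤ} {r : σ → ℕ}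
    (h : ∀ i, degreeOf i P ≤ r i) : len (hasse ℤ J P) ≤ 2 ^ (∑ i, r i) * len P := by
  rw [hasse_eq_sum]
  refine (len_sum_le _ _).trans ?_
  rw [len, Finset.mul_sum]
  refine Finset.sum_le_sum fun I hI => ?_
  rw [len_monomial, Int.cast_mul, abs_mul, mul_comm]
  refine mul_le_mul_of_nonneg_right ?_ (abs_nonneg _)
  rw [Int.cast_natCast, Nat.abs_cast, ← Finset.prod_pow_eq_pow_sum]
  norm_cast
  refine Finset.prod_le_prod' fun i _ => (Nat.choose_le_two_pow _ _).trans ?_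
  exact Nat.pow_le_pow_right (by norm_num) ((degreeOf_le_iff.mp (h i)) I hI)

theorem degreeOf_hasse_le (J : σ →₀ ℕ) (P : MvPolynomial σ ℤ) (i : σ) :
    degreeOf i (hasse ℤ J P) ≤ degreeOf i P := by
  classical
  rw [degreeOf_le_iff]
  intro K hK
  rw [hasse_eq_sum] at hK
  obtain ⟨I, hI, hK⟩ := Finset.mem_biUnion.mp (support_sum hK)
  rw [Finset.mem_singleton.mp (support_monomial_subset hK)]
  refine le_trans ?_ ((degreeOf_le_iff.mp le_rfl) I hI)
  simp

end Length

section Index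

variable {σ : Type*} [Fintype σ] {A : Type*} [CommRing A]

/-- `P` has index at least `θ` at the point `x` with respect to the weights `w`. -/
def IndexGE (w : σ → ℝ) (x : σ → A) (θ : ℝ) (P : MvPolynomial σ ℤ) : Prop :=
  ∀ J : σ →₀ ℕ, ∑ i, J i * w i < θ → aeval x (hasse ℤ J P) = 0

theorem indexGE_zero {w : σ → ℝ} (hw : ∀ i, 0 ≤ w i) (x : σ → A) (P : MvPolynomial σ ℤ) :
    IndexGE w x 0 P := fun _ hJ =>
  absurd hJ (not_lt.mpr (Finset.sum_nonneg fun i _ => mul_nonneg (Nat.cast_nonneg _) (hw i)))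

theorem IndexGE.mono {w : σ → ℝ} {x : σ → A} {θ θ' : ℝ} {P : MvPolynomial σ ℤ}
    (h : IndexGE w x θ P) (hθ : θ' ≤ θ) : IndexGE w x θ' P := fun J hJ => h J (hJ.trans_le hθ)

theorem IndexGE.hasse {w : σ → ℝ} {x : σ → A} {θ : ℝ} {P : MvPolynomial σ ℤ}
    (h : IndexGE w x θ P) (J : σ →₀ ℕ) :
    IndexGE w x (θ - ∑ i, J i * w i) (hasse ℤ J P) := by
  intro K hK
  rw [hasse_hasse, map_smul, h, smul_zero]
  simp only [Finsupp.add_apply, Nat.cast_add, add_mul, Finset.sum_add_distrib]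
  linarith

theorem IndexGE.mul {w : σ → ℝ} {x : σ → A} {a b : ℝ} {P Q : MvPolynomial σ ℤ}
    (hP : IndexGE w x a P) (hQ : IndexGE w x b Q) : IndexGE w x (a + b) (P * Q) := by
  classical
  intro J hJ
  rw [← coeff_shift, map_mul, coeff_mul]
  refine Finset.sum_eq_zero fun uv huv => ?_
  rw [Finset.HasAntidiagonal.mem_antidiagonal] at huv
  rw [coeff_shift, coeff_shift]
  rcases lt_or_ge (∑ i, (uv.1 i : ℝ) * w i) a with h | h
  · rw [hP _ h, zero_mul]
  · rw [hQ, mul_zero]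
    rw [← huv] at hJ
    simp only [Finsupp.add_apply, Nat.cast_add, add_mul, Finset.sum_add_distrib] at hJ
    linarith

theorem IndexGE.sum {w : σ → ℝ} {x : σ → A} {θ : ℝ} {ι : Type*} (s : Finset ι)
    {P : ι → MvPolynomial σ ℤ} (h : ∀ i ∈ s, IndexGE w x θ (P i)) :
    IndexGE w x θ (∑ i ∈ s, P i) := by
  intro J hJ
  rw [map_sum, map_sum]
  exact Finset.sum_eq_zero fun i hi => h i hi J hJ

theorem IndexGE.prod {w : σ → ℝ} (hw : ∀ i, 0 ≤ w i) {x : σ → A} {ι : Type*} (s : Finset ι)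
    {t : ι → ℝ} {P : ι → MvPolynomial σ ℤ} (h : ∀ i ∈ s, IndexGE w x (t i) (P i)) :
    IndexGE w x (∑ i ∈ s, t i) (∏ i ∈ s, P i) := by
  classical
  induction s using Finset.induction_on with
  | empty => simpa using indexGE_zero hw x 1
  | insert i s hi ih =>
    rw [Finset.prod_insert hi, Finset.sum_insert hi]
    exact (h i (Finset.mem_insert_self i s)).mul
      (ih fun j hj => h j (Finset.mem_insert_of_mem hj))

theorem IndexGE.det {w : σ → ℝ} (hw : ∀ i, 0 ≤ w i) {x : σ → A} {k : ℕ} {t : Fin k → ℝ}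
    {M : Matrix (Fin k) (Fin k) (MvPolynomial σ ℤ)} (h : ∀ i j, IndexGE w x (t j) (M i j)) :
    IndexGE w x (∑ j, t j) M.det := by
  rw [Matrix.det_apply]
  refine IndexGE.sum _ fun s _ => ?_
  intro J hJ
  have := IndexGE.prod hw (x := x) Finset.univ (t := t) (P := fun j => M (s j) j)
    (fun j _ => h _ j) J hJ
  rcases Int.units_eq_one_or (Equiv.Perm.sign s) with h | h <;> rw [h]
  · rw [one_smul, this]
  · rw [Units.neg_smul, one_smul, map_neg, map_neg, this, neg_zero]

end Index

section Splitting

variable {n : ℕ}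

/-- The product of a polynomial in the first variable and a polynomial in the others. -/
noncomputable def tens (ψ : MvPolynomial (Fin 1) ℤ) (φ : MvPolynomial (Fin n) ℤ) :
    MvPolynomial (Fin (n + 1)) ℤ :=
  rename (fun _ => 0) ψ * rename Fin.succ φ

theorem tens_add_left (ψ ψ' : MvPolynomial (Fin 1) ℤ) (φ : MvPolynomial (Fin n) ℤ) :
    tens (ψ + ψ') φ = tens ψ φ + tens ψ' φ := by
  simp [tens, add_mul]

theorem tens_add_right (ψ : MvPolynomial (Fin 1) ℤ) (φ φ' : MvPolynomial (Fin n) ℤ) :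
    tens ψ (φ + φ') = tens ψ φ + tens ψ φ' := by
  simp [tens, mul_add]

theorem tens_monomial (A : Fin 1 →₀ ℕ) (I : Fin n →₀ ℕ) (a b : ℤ) :
    tens (monomial A a) (monomial I b) = monomial (I.cons (A 0)) (a * b) := by
  rw [tens, rename_monomial, rename_monomial, monomial_mul]
  congr 2
  ext i
  refine Fin.cases ?_ (fun i => ?_) i
  · rw [Finsupp.add_apply, Finsupp.cons_zero, Finsupp.mapDomain_of_notMem_range I 0 (by simp)]
    rw [Finsupp.mapDomain, Finsupp.sum_fintype _ _ (by simp)]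
    simp
  · rw [Finsupp.add_apply, Finsupp.cons_succ, Finsupp.mapDomain_apply (Fin.succ_injective n),
      Finsupp.mapDomain_of_notMem_range A, zero_add]
    simp [Fin.succ_ne_zero]

theorem coeff_tens (ψ : MvPolynomial (Fin 1) ℤ) (φ : MvPolynomial (Fin n) ℤ) (a : ℕ)
    (I : Fin n →₀ ℕ) :
    coeff (I.cons a) (tens ψ φ) = coeff (Finsupp.single 0 a) ψ * coeff I φ := by
  classical
  induction ψ using MvPolynomial.induction_on' with
  | monomial A b =>
    induction φ using MvPolynomial.induction_on' with
    | monomial J c =>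
      rw [tens_monomial, coeff_monomial, coeff_monomial, coeff_monomial]
      have h1 : (J.cons (A 0) = I.cons a) ↔ A = Finsupp.single 0 a ∧ J = I := by
        constructor
        · intro h
          refine ⟨?_, ?_⟩
          · ext
            simpa using DFunLike.congr_fun h 0
          · have := congrArg Finsupp.tail h
            simpa [Finsupp.tail_cons] using this
        · rintro ⟨rfl, rfl⟩
          simp
      rw [if_congr h1 rfl rfl]
      split_ifs <;> simp_all
    | add p q hp hq => rw [tens_add_right, coeff_add, hp, hq, coeff_add, mul_add]
  | add p q hp hq => rw [tens_add_left, coeff_add, hp, hq, coeff_add, add_mul]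

theorem hasse_tens (ψ : MvPolynomial (Fin 1) ℤ) (φ : MvPolynomial (Fin n) ℤ) (K : Fin 1 →₀ ℕ)
    (J : Fin n →₀ ℕ) :
    hasse ℤ (J.cons (K 0)) (tens ψ φ) = tens (hasse ℤ K ψ) (hasse ℤ J φ) := by
  induction ψ using MvPolynomial.induction_on' with
  | monomial A b =>
    induction φ using MvPolynomial.induction_on' with
    | monomial I c =>
      rw [tens_monomial, hasse_monomial, hasse_monomial, hasse_monomial, tens_monomial]
      refine congrArg₂ (fun e c => monomial e c) ?_ ?_
      · ext i
        refine Fin.cases ?_ (fun i => ?_) i <;> simp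
      · rw [Fin.prod_univ_succ]
        simp only [Finsupp.cons_zero, Finsupp.cons_succ, Finset.univ_unique, Fin.default_eq_zero,
          Finset.prod_singleton]
        push_cast
        ring
    | add p q hp hq => rw [tens_add_right, map_add, hp, hq, map_add, tens_add_right]
  | add p q hp hq => rw [tens_add_left, map_add, hp, hq, map_add, tens_add_left]

theorem aeval_tens {A : Type*} [CommRing A] (x : Fin (n + 1) → A)
    (ψ : MvPolynomial (Fin 1) ℤ) (φ : MvPolynomial (Fin n) ℤ) :
    aeval x (tens ψ φ) = aeval (fun _ => x 0) ψ * aeval (x ∘ Fin.succ) φ := by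
  rw [tens, map_mul, aeval_rename, aeval_rename]
  rfl

/-- The coefficient of `X₀ ^ a`, as a polynomial in the remaining variables. -/
noncomputable def slice (a : ℕ) (P : MvPolynomial (Fin (n + 1)) ℤ) : MvPolynomial (Fin n) ℤ :=
  (finSuccEquiv ℤ n P).coeff a

theorem coeff_slice (a : ℕ) (P : MvPolynomial (Fin (n + 1)) ℤ) (I : Fin n →₀ ℕ) :
    coeff I (slice a P) = coeff (I.cons a) P := finSuccEquiv_coeff_coeff I P a

theorem len_slice_le (a : ℕ) (P : MvPolynomial (Fin (n + 1)) ℤ) : len (slice a P) ≤ len P := by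
  classical
  rw [len, len_eq_sum (P := P) (s := P.support ∪ (slice a P).support.image (Finsupp.cons a))
    Finset.subset_union_left]
  simp_rw [coeff_slice]
  rw [← Finset.sum_image (f := fun I => |((coeff I P : ℤ) : ℝ)|) (g := Finsupp.cons a)
    (fun _ _ _ _ h => Finsupp.cons_right_injective a h)]
  exact Finset.sum_le_sum_of_subset_of_nonneg Finset.subset_union_right fun _ _ _ => abs_nonneg _

/-- The coefficient of `X' ^ I`, as a polynomial in the first variable. -/
noncomputable def coslice (I : Fin n →₀ ℕ) (P : MvPolynomial (Fin (n + 1)) ℤ) :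
    MvPolynomial (Fin 1) ℤ :=
  ∑ K ∈ P.support with Finsupp.tail K = I, monomial (Finsupp.single 0 (K 0)) (coeff K P)

theorem coeff_coslice (I : Fin n →₀ ℕ) (P : MvPolynomial (Fin (n + 1)) ℤ) (a : ℕ) :
    coeff (Finsupp.single 0 a) (coslice I P) = coeff (I.cons a) P := by
  classical
  rw [coslice, coeff_sum]
  simp_rw [coeff_monomial]
  rw [Finset.sum_eq_single (I.cons a)]
  · simp
  · intro K hK hne
    rw [Finset.mem_filter] at hK
    rw [if_neg]
    intro h
    apply hne
    rw [← Finsupp.cons_tail K, hK.2, Finsupp.single_injective _ h]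
  · intro h
    rw [Finset.mem_filter, Finsupp.tail_cons] at h
    have : coeff (I.cons a) P = 0 := by
      by_contra h0
      exact h ⟨mem_support_iff.mpr h0, rfl⟩
    simp [this]

theorem len_coslice_le (I : Fin n →₀ ℕ) (P : MvPolynomial (Fin (n + 1)) ℤ) :
    len (coslice I P) ≤ len P := by
  refine (len_sum_le _ _).trans ?_
  simp_rw [len_monomial]
  exact Finset.sum_le_sum_of_subset_of_nonneg (Finset.filter_subset _ _) fun _ _ _ => abs_nonneg _

end Splitting

section Univariate

theorem coeff_aeval_X (U : MvPolynomial (Fin 1) ℤ) (i : ℕ) :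
    (aeval (fun _ => (Polynomial.X : Polynomial ℤ)) U).coeff i = coeff (Finsupp.single 0 i) U := by
  classical
  induction U using MvPolynomial.induction_on' with
  | monomial A b =>
    rw [aeval_monomial, Finsupp.prod_fintype _ _ (by simp), coeff_monomial]
    simp only [Finset.univ_unique, Fin.default_eq_zero, Finset.prod_singleton,
      eq_intCast]
    rw [← Polynomial.C_eq_intCast, Polynomial.coeff_C_mul_X_pow]
    refine if_congr ⟨fun h => ?_, fun h => ?_⟩ rfl rfl
    · ext
      simp [h]
    · simp [h]
  | add p q hp hq => rw [map_add, Polynomial.coeff_add, hp, hq, coeff_add]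

theorem aeval_hasse_eq_eval_hasseDeriv (U : MvPolynomial (Fin 1) ℤ) (i : ℕ) (β : ℚ) :
    aeval (fun _ => β) (hasse ℤ (Finsupp.single 0 i) U) =
      (Polynomial.hasseDeriv i
        ((aeval (fun _ => (Polynomial.X : Polynomial ℤ)) U).map (Int.castRingHom ℚ))).eval β := by
  induction U using MvPolynomial.induction_on' with
  | monomial A b =>
    rw [hasse_monomial, aeval_monomial, aeval_monomial, Finsupp.prod_fintype _ _ (by simp),
      Finsupp.prod_fintype _ _ (by simp)]
    simp only [Finset.univ_unique, Fin.default_eq_zero, Finset.prod_singleton,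
      algebraMap_int_eq, eq_intCast]
    rw [← Polynomial.C_eq_intCast, Polynomial.C_mul_X_pow_eq_monomial, Polynomial.map_monomial,
      Polynomial.hasseDeriv_monomial, Polynomial.eval_monomial]
    simp only [Finsupp.tsub_apply, Finsupp.single_eq_same, eq_intCast]
    push_cast
    ring
  | add p q hp hq => rw [map_add, map_add, hp, hq, map_add, Polynomial.map_add, map_add,
      Polynomial.eval_add]

theorem isPrimitive_C_mul_X_sub_C {p : ℤ} {q : ℤ} (hpq : IsCoprime p q) :
    (Polynomial.C q * Polynomial.X - Polynomial.C p).IsPrimitive := by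
  rw [Polynomial.isPrimitive_iff_isUnit_of_C_dvd]
  intro r hr
  rw [Polynomial.C_dvd_iff_dvd_coeff] at hr
  have h0 : r ∣ p := by simpa using hr 0
  have h1 : r ∣ q := by
    have h := hr 1
    rwa [Polynomial.coeff_sub, Polynomial.coeff_C_mul, Polynomial.coeff_X_one, mul_one,
      Polynomial.coeff_C_succ, sub_zero] at h
  exact hpq.isUnit_of_dvd' h0 h1

/-- An integer polynomial in one variable vanishes at a rational point to an order controlled by
its length. -/
theorem exists_hasse_ne_zero_univariate {U : MvPolynomial (Fin 1) ℤ} (hU : U ≠ 0) {p : ℤ} {q : ℕ}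
    (hq : 0 < q) (hpq : IsCoprime p q) :
    ∃ i : ℕ, (q : ℝ) ^ i ≤ len U ∧
      aeval (fun _ => (p / q : ℚ)) (hasse ℤ (Finsupp.single 0 i) U) ≠ 0 := by
  classical
  set β : ℚ := p / q with hβ
  let f : Polynomial ℤ := aeval (fun _ => Polynomial.X) U
  have hcoeff : ∀ i, f.coeff i = coeff (Finsupp.single 0 i) U := coeff_aeval_X U
  have hf : f ≠ 0 := by
    obtain ⟨I, hI⟩ := ne_zero_iff.mp hU
    intro h
    apply hI
    have : I = Finsupp.single 0 (I 0) := by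
      ext
      simp
    rw [this, ← hcoeff, h, Polynomial.coeff_zero]
  have hfQ : f.map (Int.castRingHom ℚ) ≠ 0 :=
    (Polynomial.map_ne_zero_iff (RingHom.injective_int _)).mpr hf
  have hex : ∃ i, (Polynomial.taylor β (f.map (Int.castRingHom ℚ))).coeff i ≠ 0 := by
    by_contra! h
    exact hfQ ((Polynomial.taylor_injective β) (by rw [map_zero]; exact Polynomial.ext h))
  obtain ⟨hi, hmin⟩ := And.intro (Nat.find_spec hex) fun j => Nat.find_min hex (m := j)
  set i := Nat.find hex
  refine ⟨i, ?_, ?_⟩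
  · have h1 : (Polynomial.X - Polynomial.C β) ^ i ∣ f.map (Int.castRingHom ℚ) := by
      rw [Polynomial.X_sub_C_pow_dvd_iff, ← Polynomial.taylor_apply, Polynomial.X_pow_dvd_iff]
      intro d hd
      have := hmin d hd
      push Not at this
      exact this
    let g : Polynomial ℤ := (Polynomial.C (q : ℤ) * Polynomial.X - Polynomial.C p) ^ i
    have hprim : g.IsPrimitive := by
      have h1 := isPrimitive_C_mul_X_sub_C hpq
      simp only [g]
      generalize i = m
      induction m with
      | zero => simp
      | succ m ih => rw [pow_succ]; exact ih.mul h1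
    have hq0 : (q : ℚ) ≠ 0 := by exact_mod_cast hq.ne'
    have hdvd : g ∣ f := by
      rw [Polynomial.IsPrimitive.Int.dvd_iff_map_cast_dvd_map_cast g f hprim]
      have h2 : g.map (Int.castRingHom ℚ) =
          Polynomial.C ((q : ℚ) ^ i) * (Polynomial.X - Polynomial.C β) ^ i := by
        simp only [g, Polynomial.map_pow, Polynomial.map_sub, Polynomial.map_mul, Polynomial.map_C,
          Polynomial.map_X, Polynomial.C_pow, ← mul_pow, mul_sub, ← Polynomial.C_mul]
        simp [hβ, mul_div_cancel₀ _ hq0]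
      rw [h2]
      exact (Polynomial.isUnit_C.mpr (pow_ne_zero i hq0).isUnit).mul_left_dvd.mpr h1
    obtain ⟨h, hh⟩ := hdvd
    have hlg : g.leadingCoeff = (q : ℤ) ^ i := by
      rw [Polynomial.leadingCoeff_pow, sub_eq_add_neg, ← Polynomial.C_neg,
        Polynomial.leadingCoeff_linear (by exact_mod_cast hq.ne')]
    have hlc : f.leadingCoeff = (q : ℤ) ^ i * h.leadingCoeff := by
      rw [hh, Polynomial.leadingCoeff_mul, hlg]
    have hlh : h.leadingCoeff ≠ 0 := by
      intro h0
      rw [h0, mul_zero, Polynomial.leadingCoeff_eq_zero] at hlc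
      exact hf hlc
    refine le_trans ?_ (abs_coeff_le_len U (Finsupp.single 0 f.natDegree))
    rw [← hcoeff, Polynomial.coeff_natDegree, hlc, Int.cast_mul, abs_mul]
    have h2 : (1 : ℝ) ≤ |((h.leadingCoeff : ℤ) : ℝ)| := by exact_mod_cast Int.one_le_abs hlh
    have h3 : (0 : ℝ) ≤ (q : ℝ) ^ i := by positivity
    simpa using le_mul_of_one_le_right h3 h2
  · rw [aeval_hasse_eq_eval_hasseDeriv, ← Polynomial.taylor_coeff]
    exact hi

end Univariate

section RothLemma

variable {n : ℕ}

/-- A nonzero multiple of `P` has a decomposition into a minimal number of split terms. -/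
theorem exists_tens_decomposition {P : MvPolynomial (Fin (n + 1)) ℤ} (hP : P ≠ 0) {r : ℕ}
    (hr : degreeOf 0 P ≤ r) :
    ∃ (k : ℕ) (d : ℤ) (ψ : Fin k → MvPolynomial (Fin 1) ℤ) (φ : Fin k → MvPolynomial (Fin n) ℤ),
      0 < k ∧ k ≤ r + 1 ∧ d ≠ 0 ∧ d • P = ∑ j, tens (ψ j) (φ j) ∧
        LinearIndependent ℤ ψ ∧ LinearIndependent ℤ φ := by
  classical
  let S : ℕ → Prop := fun k => ∃ (d : ℤ) (ψ : Fin k → MvPolynomial (Fin 1) ℤ)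
    (φ : Fin k → MvPolynomial (Fin n) ℤ), d ≠ 0 ∧ d • P = ∑ j, tens (ψ j) (φ j)
  have h0 : S (r + 1) := by
    refine ⟨1, fun a => monomial (Finsupp.single 0 a) 1, fun a => slice a P, one_ne_zero, ?_⟩
    rw [one_smul]
    ext I
    rw [← Finsupp.cons_tail I, coeff_sum]
    simp_rw [coeff_tens, coeff_slice, coeff_monomial, (Finsupp.single_injective _).eq_iff, ite_mul,
      one_mul, zero_mul]
    by_cases hI : I 0 < r + 1
    · rw [Finset.sum_eq_single ⟨I 0, hI⟩]
      · simp
      · intro a _ ha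
        rw [if_neg]
        rintro h
        exact ha (Fin.ext h)
      · simp
    · rw [Finset.sum_eq_zero fun (a : Fin (r + 1)) _ => if_neg fun (h : (a : ℕ) = I 0) =>
        hI (h ▸ a.isLt)]
      by_contra h
      rw [Finsupp.cons_tail, ← ne_eq, ← mem_support_iff] at h
      have := degreeOf_le_iff.mp hr I h
      omega
  have hex : ∃ k, S k := ⟨_, h0⟩
  obtain ⟨hk, hmin⟩ := And.intro (Nat.find_spec hex) fun j => Nat.find_min hex (m := j)
  have hle := Nat.find_min' hex h0
  generalize Nat.find hex = k at *
  obtain ⟨d, ψ, φ, hd, hdP⟩ := hk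
  refine ⟨k, d, ψ, φ, ?_, hle, hd, hdP, ?_, ?_⟩
  · rw [Nat.pos_iff_ne_zero]
    rintro rfl
    rw [Fin.sum_univ_zero, smul_eq_zero] at hdP
    exact hdP.elim hd hP
  · by_contra hdep
    rw [Fintype.not_linearIndependent_iff] at hdep
    obtain ⟨g, hg, j₀, hj₀⟩ := hdep
    obtain _ | k := k
    · exact j₀.elim0
    refine hmin k k.lt_succ_self ⟨g j₀ * d, fun j => ψ (j₀.succAbove j),
      fun j => g j₀ • φ (j₀.succAbove j) - g (j₀.succAbove j) • φ j₀, mul_ne_zero hj₀ hd, ?_⟩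
    rw [Fin.sum_univ_succAbove _ j₀] at hg hdP
    have h1 : g j₀ • tens (ψ j₀) (φ j₀) =
        - ∑ j, g (j₀.succAbove j) • tens (ψ (j₀.succAbove j)) (φ j₀) := by
      simp only [tens, ← smul_mul_assoc, ← Finset.sum_mul, ← map_zsmul, ← map_sum, ← neg_mul,
        ← map_neg]
      rw [eq_neg_of_add_eq_zero_left hg]
    rw [mul_smul, hdP, smul_add, h1, Finset.smul_sum, neg_add_eq_sub, ← Finset.sum_sub_distrib]
    refine Finset.sum_congr rfl fun j _ => ?_
    simp only [tens, map_sub, map_zsmul, mul_sub, mul_smul_comm]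
  · by_contra hdep
    rw [Fintype.not_linearIndependent_iff] at hdep
    obtain ⟨g, hg, j₀, hj₀⟩ := hdep
    obtain _ | k := k
    · exact j₀.elim0
    refine hmin k k.lt_succ_self ⟨g j₀ * d,
      fun j => g j₀ • ψ (j₀.succAbove j) - g (j₀.succAbove j) • ψ j₀,
      fun j => φ (j₀.succAbove j), mul_ne_zero hj₀ hd, ?_⟩
    rw [Fin.sum_univ_succAbove _ j₀] at hg hdP
    have h1 : g j₀ • tens (ψ j₀) (φ j₀) =
        - ∑ j, g (j₀.succAbove j) • tens (ψ j₀) (φ (j₀.succAbove j)) := by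
      simp only [tens, ← mul_smul_comm, ← Finset.mul_sum, ← map_zsmul, ← map_sum, ← mul_neg,
        ← map_neg]
      rw [eq_neg_of_add_eq_zero_left hg]
    rw [mul_smul, hdP, smul_add, h1, Finset.smul_sum, neg_add_eq_sub, ← Finset.sum_sub_distrib]
    refine Finset.sum_congr rfl fun j _ => ?_
    simp only [tens, map_sub, map_zsmul, sub_mul, smul_mul_assoc]

theorem det_hasse_eq_tens {P : MvPolynomial (Fin (n + 1)) ℤ} {k : ℕ} {d : ℤ}
    {ψ : Fin k → MvPolynomial (Fin 1) ℤ} {φ : Fin k → MvPolynomial (Fin n) ℤ}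
    (h : d • P = ∑ j, tens (ψ j) (φ j)) (K : Fin k → Fin 1 →₀ ℕ) (J : Fin k → Fin n →₀ ℕ) :
    d ^ k • (Matrix.of fun i l => hasse ℤ ((J i).cons (K l 0)) P).det =
      tens (Matrix.of fun i j => hasse ℤ (K i) (ψ j)).det
        (Matrix.of fun i j => hasse ℤ (J i) (φ j)).det := by
  classical
  have h1 : d • (Matrix.of fun i l => hasse ℤ ((J i).cons (K l 0)) P) =
      (rename Fin.succ : _ →ₐ[ℤ] MvPolynomial (Fin (n + 1)) ℤ).toRingHom.mapMatrix
          (Matrix.of fun i j => hasse ℤ (J i) (φ j)) *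
        ((rename fun _ => 0 : _ →ₐ[ℤ] MvPolynomial (Fin (n + 1)) ℤ).toRingHom.mapMatrix
          (Matrix.of fun i j => hasse ℤ (K i) (ψ j))).transpose := by
    ext1 i l
    rw [Matrix.smul_apply, Matrix.of_apply, ← map_smul, h, map_sum, Matrix.mul_apply]
    refine Finset.sum_congr rfl fun j _ => ?_
    rw [hasse_tens, tens, mul_comm]
    rfl
  have h2 := congrArg Matrix.det h1
  rw [Matrix.det_smul_of_tower, Fintype.card_fin, Matrix.det_mul, Matrix.det_transpose,
    ← RingHom.map_det, ← RingHom.map_det, mul_comm] at h2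
  exact h2

theorem hasse_ne_zero_of_smul_eq_tens {W : MvPolynomial (Fin (n + 1)) ℤ} {d : ℤ} 
    {U : MvPolynomial (Fin 1) ℤ} {V : MvPolynomial (Fin n) ℤ} (hU : U ≠ 0) (hV : V ≠ 0)
    (hd : d ≠ 0) (h : d • W = tens U V) :
    ∃ (a : ℕ) (I : Fin n →₀ ℕ), slice a W ≠ 0 ∧ coslice I W ≠ 0 ∧
      ∀ (β : Fin (n + 1) → ℚ) (i : ℕ) (J : Fin n →₀ ℕ),
        aeval (fun _ => β 0) (hasse ℤ (Finsupp.single 0 i) (coslice I W)) ≠ 0 →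
        aeval (β ∘ Fin.succ) (hasse ℤ J (slice a W)) ≠ 0 →
        aeval β (hasse ℤ (J.cons i) W) ≠ 0 := by
  obtain ⟨A, hA⟩ := ne_zero_iff.mp hU
  obtain ⟨I, hI⟩ := ne_zero_iff.mp hV
  obtain ⟨a, rfl⟩ : ∃ a, A = Finsupp.single 0 a := ⟨A 0, by ext; simp⟩
  have h1 : d • slice a W = coeff (Finsupp.single 0 a) U • V := by
    ext J
    rw [coeff_smul, coeff_slice, ← coeff_smul, h, coeff_tens, coeff_smul, smul_eq_mul]
  have h2 : d • coslice I W = coeff I V • U := by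
    ext J
    obtain ⟨b, rfl⟩ : ∃ b, J = Finsupp.single 0 b := ⟨J 0, by ext; simp⟩
    rw [coeff_smul, coeff_coslice, ← coeff_smul, h, coeff_tens, coeff_smul, smul_eq_mul, mul_comm]
  refine ⟨a, I, ?_, ?_, fun β i J hi hJ h0 => ?_⟩
  · intro h0
    rw [h0, smul_zero, eq_comm, smul_eq_zero] at h1
    exact h1.elim hA hV
  · intro h0
    rw [h0, smul_zero, eq_comm, smul_eq_zero] at h2
    exact h2.elim hI hU
  · have h3 : aeval β (hasse ℤ (J.cons i) (d • W)) = 0 := by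
      rw [map_smul, map_smul, h0, smul_zero]
    have h4 := hasse_tens U V (Finsupp.single 0 i) J
    rw [Finsupp.single_eq_same] at h4
    rw [h, h4, aeval_tens, mul_eq_zero] at h3
    rcases h3 with h3 | h3
    · have := congrArg (fun Q => aeval (fun _ => β 0) (hasse ℤ (Finsupp.single 0 i) Q)) h2
      simp only [map_smul, h3, smul_zero, smul_eq_zero] at this
      exact this.elim hd hi
    · have := congrArg (fun Q => aeval (β ∘ Fin.succ) (hasse ℤ J Q)) h1
      simp only [map_smul, h3, smul_zero, smul_eq_zero] at this
      exact this.elim hd hJ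

theorem sum_max_sub_div_ge {s : ℝ} (hs : 0 ≤ s) (hs1 : s ≤ 1) {k r : ℕ} (hr : 0 < r)
    (hk : k ≤ r + 1) : k * s ^ 2 / 8 ≤ ∑ l : Fin k, max 0 (s - (l : ℕ) / r) := by
  rw [Fin.sum_univ_eq_sum_range (fun l => max 0 (s - (l : ℝ) / r))]
  have hr' : (1 : ℝ) ≤ r := by exact_mod_cast hr
  have hk' : (k : ℝ) ≤ r + 1 := by exact_mod_cast hk
  have hN : ⌈k * s / 4⌉₊ ≤ k := by
    rw [Nat.ceil_le]
    nlinarith [(Nat.cast_nonneg k : (0 : ℝ) ≤ k)]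
  refine le_trans ?_ (Finset.sum_le_sum_of_subset_of_nonneg (Finset.range_mono hN)
    fun _ _ _ => le_max_left _ _)
  have h1 : ∀ l ∈ Finset.range ⌈k * s / 4⌉₊, s / 2 ≤ max 0 (s - (l : ℝ) / r) := by
    intro l hl
    rw [Finset.mem_range, Nat.lt_ceil] at hl
    refine le_max_of_le_right ?_
    have : (l : ℝ) / r ≤ s / 2 := by
      rw [div_le_iff₀ (by linarith)]
      nlinarith
    linarith
  refine le_trans ?_ (Finset.sum_le_sum h1)
  rw [Finset.sum_const, Finset.card_range, nsmul_eq_mul]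
  nlinarith [Nat.le_ceil (k * s / 4)]

/-- The conclusion of Roth's lemma in `n` variables, for the parameters `η` and `ω`. -/
def RothLemmaFor (n : ℕ) (η ω : ℝ) : Prop :=
  ∀ (r : Fin n → ℕ) (p : Fin n → ℤ) (q : Fin n → ℕ) (Λ : ℝ) (P : MvPolynomial (Fin n) ℤ),
    (∀ i, 0 < r i) → (∀ i j, i < j → (r i : ℝ) ≤ ω * r j) → (∀ i, (r i : ℝ) ≤ ω * Λ) →
    (∀ i, IsCoprime (p i) (q i : ℤ)) → (∀ i, 0 < q i) → (∀ i, Λ ≤ r i * Real.log (q i)) →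
    P ≠ 0 → (∀ i, degreeOf i P ≤ r i) → len P ≤ Real.exp (ω * Λ) →
    ∃ J : Fin n →₀ ℕ, ∑ i, J i * (1 / r i : ℝ) ≤ η ∧
      aeval (fun i => (p i / q i : ℚ)) (hasse ℤ J P) ≠ 0

theorem rothLemmaFor_succ {n : ℕ} {η ω ω' : ℝ} (hη : 0 < η) (hη1 : η ≤ 1) (hω : 0 < ω)
    (hω1 : ω ≤ η / 2) (hω2 : (n + 3) * ω ≤ η ^ 2 / 128) (hω3 : (n + 3) * ω ≤ ω')
    (ih : RothLemmaFor n (η ^ 2 / 128) ω') : RothLemmaFor (n + 1) η ω := by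
  intro r p q Λ P hr hrω hrΛ hpq hq hΛq hP hdeg hlen
  have hr1 : ∀ i, (1 : ℝ) ≤ r i := fun i => by exact_mod_cast hr i
  have hΛ : 0 < Λ := by
    have := (hr1 0).trans (hrΛ 0)
    by_contra h
    nlinarith
  by_contra! hcon
  set β : Fin (n + 1) → ℚ := fun i => p i / q i with hβ
  have hP0 : IndexGE (fun i => 1 / r i) β η P := fun J hJ => hcon J hJ.le
  obtain ⟨k, d, ψ, φ, hk0, hk, hd, hdP, hψ, hφ⟩ := exists_tens_decomposition hP (hdeg 0)
  obtain ⟨K, hK, hKdet⟩ := exists_hasse_det_ne_zero ψ hψ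
  obtain ⟨J, hJ, hJdet⟩ := exists_hasse_det_ne_zero φ hφ
  have hW := det_hasse_eq_tens hdP K J
  set M : Matrix (Fin k) (Fin k) (MvPolynomial (Fin (n + 1)) ℤ) :=
    Matrix.of fun i l => hasse ℤ ((J i).cons (K l 0)) P with hM
  have hk1 : (1 : ℝ) ≤ k := by exact_mod_cast hk0
  have hkr : (k : ℝ) ≤ r 0 + 1 := by exact_mod_cast hk
  have hexp : (k : ℝ) ≤ Real.exp (ω * Λ) :=
    hkr.trans ((Real.add_one_le_exp _).trans (Real.exp_le_exp.mpr (hrΛ 0)))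
  have hlenM : ∀ i l, len (M i l) ≤ Real.exp ((n + 2) * (ω * Λ)) := by
    intro i l
    refine (len_hasse_le _ hdeg).trans ?_
    have h1 : (2 : ℝ) ^ (∑ i, r i) ≤ Real.exp ((n + 1) * (ω * Λ)) := by
      have h2 : (2 : ℝ) ≤ Real.exp 1 := by linarith [Real.add_one_le_exp (1 : ℝ)]
      refine (pow_le_pow_left₀ (by norm_num) h2 _).trans ?_
      rw [← Real.exp_nat_mul, mul_one, Real.exp_le_exp, Nat.cast_sum]
      refine (Finset.sum_le_sum fun i _ => hrΛ i).trans ?_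
      simp
    calc _ ≤ Real.exp ((n + 1) * (ω * Λ)) * Real.exp (ω * Λ) :=
          mul_le_mul h1 hlen (len_nonneg _) (Real.exp_pos _).le
      _ = _ := by rw [← Real.exp_add]; ring_nf
  have hlenW : len M.det ≤ Real.exp (k * ((n + 3) * (ω * Λ))) := by
    refine (len_det_le M hlenM).trans ?_
    have h1 : (k.factorial : ℝ) ≤ Real.exp (ω * Λ) ^ k :=
      le_trans (by exact_mod_cast Nat.factorial_le_pow k) (pow_le_pow_left₀ (by positivity) hexp k)
    refine (mul_le_mul_of_nonneg_right h1 (by positivity)).trans_eq ?_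
    rw [← mul_pow, ← Real.exp_add, ← Real.exp_nat_mul]
    ring_nf
  have hdegW : ∀ i, degreeOf i M.det ≤ k * r i := fun i =>
    degreeOf_det_le M fun a b => (degreeOf_hasse_le _ _ _).trans (hdeg i)
  have hindex : IndexGE (fun i => 1 / r i) β
      (∑ l : Fin k, max 0 (η / 2 - (l : ℕ) / r 0)) M.det := by
    refine IndexGE.det (fun i => by positivity) fun i l => ?_
    rcases max_cases 0 (η / 2 - (l : ℕ) / r 0 : ℝ) with h | h
    · rw [h.1]
      exact indexGE_zero (fun i => by positivity) _ _
    · rw [h.1]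
      refine (hP0.hasse _).mono ?_
      rw [Fin.sum_univ_succ]
      simp only [Finsupp.cons_zero, Finsupp.cons_succ]
      have h1 : (K l 0 : ℝ) * (1 / r 0) ≤ (l : ℕ) / r 0 := by
        rw [mul_one_div]
        have : K l 0 ≤ l := le_trans (by rw [Finsupp.degree_eq_sum]; simp) (hK l)
        gcongr
      have h2 : ∑ h : Fin n, (J i h : ℝ) * (1 / r h.succ) ≤ ω := by
        have h3 : ∀ h : Fin n, (J i h : ℝ) * (1 / r h.succ) ≤ J i h * (ω / r 0) := by
          intro h
          refine mul_le_mul_of_nonneg_left ?_ (by positivity)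
          rw [div_le_div_iff₀ (by linarith [hr1 h.succ]) (by linarith [hr1 0]), one_mul]
          exact hrω 0 h.succ (Fin.succ_pos h)
        refine (Finset.sum_le_sum fun h _ => h3 h).trans ?_
        rw [← Finset.sum_mul, ← Nat.cast_sum, ← Finsupp.degree_eq_sum]
        have h4 : (J i).degree ≤ r 0 := (hJ i).trans (by omega)
        have h5 : ((J i).degree : ℝ) ≤ r 0 := by exact_mod_cast h4
        rw [mul_div_assoc', div_le_iff₀ (by linarith [hr1 0]), mul_comm ω]
        exact mul_le_mul_of_nonneg_right h5 hω.le
      linarith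
  obtain ⟨a, I, ha, hI, hne⟩ := hasse_ne_zero_of_smul_eq_tens hKdet hJdet (pow_ne_zero k hd) hW
  obtain ⟨i, hi, hi0⟩ := exists_hasse_ne_zero_univariate hI (hq 0) (hpq 0)
  have c1 : ∀ i j : Fin n, i < j → ((k * r i.succ : ℕ) : ℝ) ≤ ω' * (k * r j.succ : ℕ) := by
    intro i j hij
    push_cast
    have := hrω i.succ j.succ (Fin.succ_lt_succ_iff.mpr hij)
    have h1 : ω ≤ ω' := by nlinarith [(Nat.cast_nonneg n : (0 : ℝ) ≤ n)]
    nlinarith [mul_le_mul_of_nonneg_right h1 (by linarith [hr1 j.succ] : (0 : ℝ) ≤ r j.succ)]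
  have c2 : ∀ i : Fin n, ((k * r i.succ : ℕ) : ℝ) ≤ ω' * (k * Λ) := by
    intro i
    push_cast
    have := hrΛ i.succ
    have h1 : ω ≤ ω' := by nlinarith [(Nat.cast_nonneg n : (0 : ℝ) ≤ n)]
    nlinarith [mul_le_mul_of_nonneg_right h1 hΛ.le]
  have c3 : ∀ i : Fin n, k * Λ ≤ (k * r i.succ : ℕ) * Real.log (q i.succ) := by
    intro i
    push_cast
    rw [mul_assoc]
    exact mul_le_mul_of_nonneg_left (hΛq _) (by linarith)
  have c4 : ∀ i : Fin n, degreeOf i (slice a M.det) ≤ k * r i.succ := by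
    intro i
    exact (degreeOf_coeff_finSuccEquiv _ i a).trans (hdegW i.succ)
  have c5 : len (slice a M.det) ≤ Real.exp (ω' * (k * Λ)) := by
    refine (len_slice_le _ _).trans (hlenW.trans (Real.exp_le_exp.mpr ?_))
    calc (k : ℝ) * ((n + 3) * (ω * Λ)) = ((n + 3) * ω) * (k * Λ) := by ring
      _ ≤ _ := mul_le_mul_of_nonneg_right hω3 (by positivity)
  obtain ⟨J', hJ', hJ0⟩ := ih (fun i => k * r i.succ) (fun i => p i.succ) (fun i => q i.succ)
    (k * Λ) (slice a M.det) (fun i => Nat.mul_pos hk0 (hr _)) c1 c2 (fun i => hpq _)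
    (fun i => hq _) c3 ha c4 c5
  refine hne β i J' hi0 hJ0 (hindex _ ?_)
  refine lt_of_lt_of_le ?_ (sum_max_sub_div_ge (by linarith) (by linarith) (hr 0) hk)
  rw [Fin.sum_univ_succ]
  simp only [Finsupp.cons_zero, Finsupp.cons_succ]
  have h1 : (i : ℝ) * (1 / r 0) ≤ k * (η ^ 2 / 128) := by
    have h2 : (i : ℝ) * Real.log (q 0) ≤ k * ((n + 3) * (ω * Λ)) := by
      rw [← Real.log_pow, Real.log_le_iff_le_exp (by have := hq 0; positivity)]
      exact hi.trans ((len_coslice_le _ _).trans hlenW)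
    have h3 : (i : ℝ) * Λ ≤ k * (η ^ 2 / 128) * r 0 * Λ := by
      calc (i : ℝ) * Λ ≤ i * (r 0 * Real.log (q 0)) :=
            mul_le_mul_of_nonneg_left (hΛq 0) (by positivity)
        _ = r 0 * (i * Real.log (q 0)) := by ring
        _ ≤ r 0 * (k * ((n + 3) * (ω * Λ))) := mul_le_mul_of_nonneg_left h2 (by positivity)
        _ = ((n + 3) * ω) * (k * r 0 * Λ) := by ring
        _ ≤ (η ^ 2 / 128) * (k * r 0 * Λ) := mul_le_mul_of_nonneg_right hω2 (by positivity)
        _ = _ := by ring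
    rw [mul_one_div, div_le_iff₀ (by linarith [hr1 0])]
    exact le_of_mul_le_mul_right h3 hΛ
  have h2 : ∑ h : Fin n, (J' h : ℝ) * (1 / r h.succ) ≤ k * (η ^ 2 / 128) := by
    refine le_trans (le_of_eq ?_) (mul_le_mul_of_nonneg_left hJ' (by linarith : (0 : ℝ) ≤ k))
    rw [Finset.mul_sum]
    refine Finset.sum_congr rfl fun h _ => ?_
    push_cast
    have := hr1 h.succ
    field_simp
  have h3 : 0 < k * η ^ 2 := by positivity
  nlinarith

theorem RothLemmaFor.mono {n : ℕ} {η η' ω : ℝ} (h : RothLemmaFor n η ω) (hη : η ≤ η') :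
    RothLemmaFor n η' ω := by
  intro r p q Λ P h1 h2 h3 h4 h5 h6 h7 h8 h9
  obtain ⟨J, hJ, hJ0⟩ := h r p q Λ P h1 h2 h3 h4 h5 h6 h7 h8 h9
  exact ⟨J, hJ.trans hη, hJ0⟩

/-- **Roth's lemma**. -/
theorem exists_rothLemmaFor (n : ℕ) : ∀ η : ℝ, 0 < η → ∃ ω : ℝ, 0 < ω ∧ RothLemmaFor n η ω := by
  induction n with
  | zero =>
    intro η hη
    refine ⟨1, one_pos, fun r p q Λ P _ _ _ _ _ _ hP _ _ => ⟨0, by simpa using hη.le, ?_⟩⟩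
    rw [hasse_zero]
    rw [eq_C_of_isEmpty P] at hP ⊢
    simpa using hP
  | succ n ih =>
    intro η hη
    have hη1 : 0 < min η 1 := lt_min hη one_pos
    obtain ⟨ω', hω', h⟩ := ih (min η 1 ^ 2 / 128) (by positivity)
    have hn : (0 : ℝ) < n + 3 := by positivity
    refine ⟨min (min η 1 / 2) (min (min η 1 ^ 2 / 128 / (n + 3)) (ω' / (n + 3))), by positivity,
      (rothLemmaFor_succ hη1 (min_le_right _ _) (by positivity) (min_le_left _ _) ?_ ?_ h).mono
        (min_le_left _ _)⟩
    · rw [← le_div_iff₀' hn]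
      exact (min_le_right _ _).trans (min_le_left _ _)
    · rw [← le_div_iff₀' hn]
      exact (min_le_right _ _).trans (min_le_right _ _)

end RothLemma

section AuxiliaryPolynomial

open scoped Matrix.Norms.Elementwise

theorem IsIntegral.exists_pow_eq_sum {α : ℂ} (hα : IsIntegral ℤ α) :
    ∃ d A : ℕ, ∀ e : ℕ, ∃ a : ℕ → ℤ, (∀ t, |a t| ≤ (A : ℤ) ^ e) ∧
      α ^ e = ∑ t ∈ Finset.range (d + 1), a t * α ^ t := by
  obtain ⟨f, hf, hfα⟩ := hα
  obtain ⟨d, hd⟩ : ∃ d, f.natDegree = d + 1 := by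
    refine Nat.exists_eq_succ_of_ne_zero fun h => ?_
    rw [hf.natDegree_eq_zero.mp h] at hfα
    simp at hfα
  have hrel : α ^ (d + 1) = - ∑ t ∈ Finset.range (d + 1), (f.coeff t : ℂ) * α ^ t := by
    rw [Polynomial.eval₂_eq_sum_range, hd, Finset.sum_range_succ, ← hd, hf.coeff_natDegree,
      hd] at hfα
    simp only [algebraMap_int_eq, eq_intCast, Int.cast_one, one_mul] at hfα
    exact eq_neg_of_add_eq_zero_right hfα
  refine ⟨d, 1 + ∑ t ∈ Finset.range (d + 2), (f.coeff t).natAbs, fun e => ?_⟩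
  have hA : ∀ t, 1 + |f.coeff t| ≤
      ((1 + ∑ t ∈ Finset.range (d + 2), (f.coeff t).natAbs : ℕ) : ℤ) := by
    intro t
    push_cast
    by_cases ht : t ∈ Finset.range (d + 2)
    · have := Finset.single_le_sum (f := fun t => |f.coeff t|) (fun _ _ => abs_nonneg _) ht
      simpa using this
    · rw [Polynomial.coeff_eq_zero_of_natDegree_lt (by rw [Finset.mem_range] at ht; omega)]
      have : 0 ≤ ∑ t ∈ Finset.range (d + 2), |f.coeff t| :=
        Finset.sum_nonneg fun _ _ => abs_nonneg _
      simpa using this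
  set A : ℕ := 1 + ∑ t ∈ Finset.range (d + 2), (f.coeff t).natAbs
  induction e with
  | zero =>
    refine ⟨fun t => if t = 0 then 1 else 0, fun t => ?_, ?_⟩
    · dsimp only
      split_ifs <;> simp
    · simp
  | succ e ih =>
    obtain ⟨a, ha, hae⟩ := ih
    refine ⟨fun t => (if t = 0 then 0 else a (t - 1)) - a d * f.coeff t, fun t => ?_, ?_⟩
    · have h1 : |if t = 0 then 0 else a (t - 1)| ≤ (A : ℤ) ^ e := by
        split_ifs
        · simp
        · exact ha _
      calc _ ≤ |if t = 0 then 0 else a (t - 1)| + |a d * f.coeff t| := abs_sub _ _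
        _ ≤ (A : ℤ) ^ e + A ^ e * |f.coeff t| := by
          rw [abs_mul]
          exact add_le_add h1 (mul_le_mul_of_nonneg_right (ha d) (abs_nonneg _))
        _ = A ^ e * (1 + |f.coeff t|) := by ring
        _ ≤ A ^ e * A := mul_le_mul_of_nonneg_left (hA t) (by positivity)
        _ = _ := (pow_succ _ _).symm
    · rw [pow_succ, hae, Finset.sum_range_succ, add_mul, mul_assoc, ← pow_succ, hrel]
      push_cast
      simp_rw [sub_mul, mul_assoc]
      rw [Finset.sum_sub_distrib, ← Finset.mul_sum, mul_neg, ← sub_eq_add_neg, Finset.sum_mul,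
        Finset.sum_range_succ' (fun t => (if t = 0 then (0 : ℂ) else a (t - 1)) * α ^ t)]
      simp [pow_succ, mul_assoc]

theorem sum_exp_symmetric_le {r : ℕ} (hr : 0 < r) (s : ℝ) :
   
    ∑ j ∈ Finset.range (r + 1), Real.exp (s * (1 / 2 - j * (1 / r))) ≤
      (r + 1) * Real.exp (s ^ 2 / 8) := by
  have hr' : (0 : ℝ) < r := by exact_mod_cast hr
  have hrefl : ∑ j ∈ Finset.range (r + 1), Real.exp (s * (1 / 2 - j * (1 / r))) =
      ∑ j ∈ Finset.range (r + 1), Real.exp (-(s * (1 / 2 - j * (1 / r)))) := by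
    rw [← Finset.sum_range_reflect]
    refine Finset.sum_congr rfl fun j hj => ?_
    rw [Finset.mem_range] at hj
    congr 1
    rw [Nat.add_sub_cancel, Nat.cast_sub (by omega)]
    field_simp
    ring
  have h2 : ∑ j ∈ Finset.range (r + 1), Real.exp (s * (1 / 2 - j * (1 / r))) =
      ∑ j ∈ Finset.range (r + 1), Real.cosh (s * (1 / 2 - j * (1 / r))) := by
    simp_rw [Real.cosh_eq]
    rw [← Finset.sum_div, Finset.sum_add_distrib, ← hrefl]
    ring
  rw [h2]
  refine (Finset.sum_le_card_nsmul _ _ (Real.exp (s ^ 2 / 8)) fun j hj => ?_).trans_eq (by simp)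
  refine (Real.cosh_le_exp_half_sq _).trans (Real.exp_le_exp.mpr ?_)
  have hj' : (j : ℝ) ≤ r := by exact_mod_cast Nat.lt_succ_iff.mp (Finset.mem_range.mp hj)
  have h3 : (j : ℝ) * (1 / r) ≤ 1 := by rwa [mul_one_div, div_le_one hr']
  have h4 : (0 : ℝ) ≤ j * (1 / r) := by positivity
  have h5 : (1 / 2 - j * (1 / r) : ℝ) ^ 2 ≤ 1 / 4 := by nlinarith
  rw [mul_pow]
  nlinarith [sq_nonneg s]

theorem card_index_lt_le {m : ℕ} {r : Fin m → ℕ} (hr : ∀ h, 0 < r h) {δ : ℝ} (hδ : 0 < δ) :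
    (Fintype.card {J : (h : Fin m) → Fin (r h + 1) //
      ∑ h, (J h : ℕ) * (1 / r h : ℝ) < m * (1 / 2 - δ)} : ℝ) * Real.exp (2 * m * δ ^ 2) ≤
      ∏ h, ((r h : ℝ) + 1) := by
  classical
  set S := Finset.univ.filter fun J : (h : Fin m) → Fin (r h + 1) =>
    ∑ h, (J h : ℕ) * (1 / r h : ℝ) < m * (1 / 2 - δ) with hS
  have h1 : ∀ J ∈ S, Real.exp (4 * m * δ ^ 2) ≤
      ∏ h, Real.exp (4 * δ * (1 / 2 - (J h : ℕ) * (1 / r h))) := by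
    intro J hJ
    rw [hS, Finset.mem_filter] at hJ
    rw [← Real.exp_sum, Real.exp_le_exp, ← Finset.mul_sum, Finset.sum_sub_distrib]
    simp only [Finset.sum_const, Finset.card_univ, Fintype.card_fin, nsmul_eq_mul]
    nlinarith [hJ.2]
  have h2 : (S.card : ℝ) * Real.exp (4 * m * δ ^ 2) ≤
      ∏ h, (((r h : ℝ) + 1) * Real.exp ((4 * δ) ^ 2 / 8)) := by
    rw [← nsmul_eq_mul]
    refine (Finset.card_nsmul_le_sum _ _ _ h1).trans ?_
    refine (Finset.sum_le_sum_of_subset_of_nonneg (Finset.subset_univ _) fun J _ _ =>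
      Finset.prod_nonneg fun h _ => (Real.exp_pos _).le).trans ?_
    rw [← Fintype.prod_sum (fun h (j : Fin (r h + 1)) =>
      Real.exp (4 * δ * (1 / 2 - (j : ℕ) * (1 / r h))))]
    refine Finset.prod_le_prod (fun h _ => Finset.sum_nonneg fun _ _ => (Real.exp_pos _).le)
      fun h _ => ?_
    rw [Fin.sum_univ_eq_sum_range (fun j => Real.exp (4 * δ * (1 / 2 - (j : ℝ) * (1 / r h))))]
    exact sum_exp_symmetric_le (hr h) _
  rw [Finset.prod_mul_distrib, Finset.prod_const, Finset.card_univ, Fintype.card_fin,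
    ← Real.exp_nat_mul] at h2
  rw [Fintype.card_subtype]
  refine le_of_mul_le_mul_right ?_ (Real.exp_pos (2 * m * δ ^ 2))
  rw [mul_assoc, ← Real.exp_add]
  have h3 : 2 * m * δ ^ 2 + 2 * m * δ ^ 2 = 4 * m * δ ^ 2 := by ring
  have h4 : m * ((4 * δ) ^ 2 / 8) = 2 * m * δ ^ 2 := by ring
  rw [h3, ← h4]
  exact h2

/-- Siegel's lemma applied to the vanishing of derivatives at `(α, …, α)`. -/
theorem exists_auxiliary_polynomial {α : ℂ} (hα : IsIntegral ℤ α) :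
    ∃ (C : ℝ) (d : ℕ), 1 ≤ C ∧ 1 ≤ d ∧ ∀ (m : ℕ) (r : Fin m → ℕ) (δ : ℝ), (∀ h, 0 < r h) →
      0 < δ → δ < 1 / 2 → 2 * d ≤ Real.exp (2 * m * δ ^ 2) →
      ∃ P : MvPolynomial (Fin m) ℤ, P ≠ 0 ∧ (∀ h, degreeOf h P ≤ r h) ∧
        len P ≤ C ^ (∑ h, r h) ∧
        IndexGE (fun h => 1 / r h) (fun _ => α) (m * (1 / 2 - δ)) P := by
  classical
  obtain ⟨d, A, hA⟩ := hα.exists_pow_eq_sum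
  choose a ha hae using hA
  refine ⟨8 * (A + 1), d + 1, by linarith [(Nat.cast_nonneg A : (0 : ℝ) ≤ A)], by omega,
    fun m r δ hr hδ hδ2 hm => ?_⟩
  let Idx := (h : Fin m) → Fin (r h + 1)
  let Low := {J : Idx // ∑ h, (J h : ℕ) * (1 / r h : ℝ) < m * (1 / 2 - δ)}
  let e : Idx → (Fin m →₀ ℕ) := fun I => Finsupp.equivFunOnFinite.symm fun h => (I h : ℕ)
  let N : ℝ := ∏ h, ((r h : ℝ) + 1)
  have hcardIdx : (Fintype.card Idx : ℝ) = N := by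
    simp [Idx, N, Fintype.card_pi]
  have hcard : 2 * (Fintype.card (Low × Fin (d + 1)) : ℝ) ≤ Fintype.card Idx := by
    have := card_index_lt_le hr hδ
    rw [Fintype.card_prod, Fintype.card_fin, hcardIdx]
    push_cast at hm ⊢
    nlinarith [mul_le_mul_of_nonneg_left hm (Nat.cast_nonneg (Fintype.card Low) : (0 : ℝ) ≤ _)]
  have hm0 : 0 < m := by
    rw [Nat.pos_iff_ne_zero]
    rintro rfl
    push_cast at hm
    simp at hm
    nlinarith [(Nat.cast_nonneg d : (0 : ℝ) ≤ d)]
  have hpos : 0 < Fintype.card (Low × Fin (d + 1)) := by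
    refine Fintype.card_pos_iff.mpr ⟨⟨⟨fun _ => 0, ?_⟩, 0⟩⟩
    have : (0 : ℝ) < m := by exact_mod_cast hm0
    simp
    nlinarith
  have hpos' : (0 : ℝ) < Fintype.card (Low × Fin (d + 1)) := by exact_mod_cast hpos
  let B : Matrix (Low × Fin (d + 1)) Idx ℤ := Matrix.of fun Jt I =>
    ((∏ h, (I h : ℕ).choose (Jt.1.1 h) : ℕ) : ℤ) * a (e I - e Jt.1.1).degree Jt.2
  obtain ⟨t, ht, hBt, htn⟩ := Int.Matrix.exists_ne_zero_int_vec_norm_le B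
    (by
      have : (Fintype.card (Low × Fin (d + 1)) : ℝ) < Fintype.card Idx := by linarith
      exact_mod_cast this) hpos
  let P : MvPolynomial (Fin m) ℤ := ∑ I, monomial (e I) (t I)
  have he : Function.Injective e := fun I I' h => by
    funext h'
    exact Fin.ext (DFunLike.congr_fun h h')
  have hcoeff : ∀ I, coeff (e I) P = t I := by
    intro I
    simp only [P, coeff_sum, coeff_monomial]
    rw [Finset.sum_eq_single I (fun I' _ h => if_neg (he.ne h)) (by simp), if_pos rfl]
  have hsupp : P.support ⊆ Finset.univ.image e := by
    intro K hK
    obtain ⟨I, -, hI⟩ := Finset.mem_biUnion.mp (support_sum hK)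
    rw [Finset.mem_singleton.mp (support_monomial_subset hI)]
    exact Finset.mem_image_of_mem _ (Finset.mem_univ _)
  refine ⟨P, ?_, fun h => ?_, ?_, ?_⟩
  · intro h
    apply ht
    funext I
    rw [← hcoeff, h, coeff_zero, Pi.zero_apply]
  · rw [degreeOf_le_iff]
    intro K hK
    obtain ⟨I, -, rfl⟩ := Finset.mem_image.mp (hsupp hK)
    exact Nat.lt_succ_iff.mp (I h).isLt
  · set R := ∑ h, r h with hR
    have hN : N ≤ 2 ^ R := by
      rw [hR, ← Finset.prod_pow_eq_pow_sum]
      refine Finset.prod_le_prod (fun h _ => by positivity) fun h _ => ?_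
      exact_mod_cast Nat.lt_two_pow_self
    have hB : ‖B‖ ≤ (2 * (A + 1)) ^ R := by
      rw [Matrix.norm_le_iff (by positivity)]
      intro Jt I
      simp only [B, Matrix.of_apply]
      rw [Int.norm_eq_abs, Int.cast_mul, abs_mul, mul_pow]
      refine mul_le_mul ?_ ?_ (abs_nonneg _) (by positivity)
      · rw [hR, ← Finset.prod_pow_eq_pow_sum, Int.cast_natCast, Nat.abs_cast]
        have : ∏ h, (I h : ℕ).choose (Jt.1.1 h) ≤ ∏ h, 2 ^ r h :=
          Finset.prod_le_prod' fun h _ => (Nat.choose_le_two_pow _ _).trans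
            (Nat.pow_le_pow_right (by norm_num) (Nat.lt_succ_iff.mp (I h).isLt))
        exact_mod_cast this
      · have h1 : (e I - e Jt.1.1).degree ≤ R := by
          rw [Finsupp.degree_eq_sum]
          refine Finset.sum_le_sum fun h _ => ?_
          exact (Nat.sub_le _ _).trans (Nat.lt_succ_iff.mp (I h).isLt)
        have h2 : |((a (e I - e Jt.1.1).degree Jt.2 : ℤ) : ℝ)| ≤
            (A : ℝ) ^ (e I - e Jt.1.1).degree := by exact_mod_cast ha _ _
        refine h2.trans ((pow_le_pow_left₀ (by positivity) (by linarith) _).trans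
          (pow_le_pow_right₀ (by linarith [(Nat.cast_nonneg A : (0 : ℝ) ≤ A)]) h1))
    have hB1 : max 1 ‖B‖ ≤ (2 * (A + 1)) ^ R :=
      max_le (one_le_pow₀ (by linarith [(Nat.cast_nonneg A : (0 : ℝ) ≤ A)])) hB
    have hN1 : 1 ≤ N := by
      rw [← hcardIdx]
      linarith [show (1 : ℝ) ≤ Fintype.card (Low × Fin (d + 1)) by exact_mod_cast hpos]
    have htn' : ‖t‖ ≤ N * max 1 ‖B‖ := by
      refine htn.trans ?_
      rw [hcardIdx] at hcard ⊢
      refine (Real.rpow_le_rpow_of_exponent_le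
        (one_le_mul_of_one_le_of_one_le hN1 (le_max_left _ _)) ?_).trans_eq (Real.rpow_one _)
      rw [div_le_one (by linarith)]
      linarith
    calc len P ≤ ∑ I, |((t I : ℤ) : ℝ)| := by
          refine (len_sum_le _ _).trans_eq ?_
          simp_rw [len_monomial]
      _ ≤ ∑ _I : Idx, ‖t‖ := Finset.sum_le_sum fun I _ => by
          rw [← Int.norm_eq_abs]
          exact norm_le_pi_norm t I
      _ = N * ‖t‖ := by rw [Finset.sum_const, Finset.card_univ, nsmul_eq_mul, hcardIdx]
      _ ≤ 2 ^ R * (2 ^ R * (2 * (A + 1)) ^ R) :=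
          mul_le_mul hN (htn'.trans (mul_le_mul hN hB1 (by positivity) (by positivity)))
            (norm_nonneg _) (by positivity)
      _ = _ := by rw [← mul_pow, ← mul_pow]; ring_nf
  · intro J hJ
    simp only [P, map_sum, hasse_monomial, aeval_monomial]
    by_cases hJr : ∃ h, r h < J h
    · obtain ⟨h, hh⟩ := hJr
      refine Finset.sum_eq_zero fun I _ => ?_
      rw [Finset.prod_eq_zero (Finset.mem_univ h)]
      · simp
      · exact Nat.choose_eq_zero_of_lt ((Nat.lt_succ_iff.mp (I h).isLt).trans_lt hh)
    · push Not at hJr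
      let J' : Idx := fun h => ⟨J h, Nat.lt_succ_iff.mpr (hJr h)⟩
      have hJ' : e J' = J := by
        ext h
        rfl
      have h1 : ∀ s : Fin (d + 1), ∑ I, B (⟨J', hJ⟩, s) I * t I = 0 := fun s =>
        congrFun hBt (⟨J', hJ⟩, s)
      have h2 : ∀ I, algebraMap ℤ ℂ (t I * ((∏ h, (e I h).choose (J h) : ℕ) : ℤ)) *
          (e I - J).prod (fun _ k => α ^ k) =
          ∑ s : Fin (d + 1), ((B (⟨J', hJ⟩, s) I * t I : ℤ) : ℂ) * α ^ (s : ℕ) := by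
        intro I
        have h3 : (e I - J).prod (fun _ k => α ^ k) = α ^ (e I - J).degree := by
          rw [Finsupp.prod_fintype _ _ (by simp), Finset.prod_pow_eq_pow_sum,
            ← Finsupp.degree_eq_sum]
        rw [h3, hae, ← Fin.sum_univ_eq_sum_range
          (fun s => (a (e I - J).degree s : ℂ) * α ^ s), Finset.mul_sum]
        refine Finset.sum_congr rfl fun s _ => ?_
        simp only [B, Matrix.of_apply, hJ', algebraMap_int_eq, eq_intCast]
        simp only [J', e, Finsupp.equivFunOnFinite_symm_apply_apply]
        push_cast
        ring
      rw [Finset.sum_congr rfl fun I _ => h2 I, Finset.sum_comm]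
      refine Finset.sum_eq_zero fun s _ => ?_
      rw [← Finset.sum_mul, ← Int.cast_sum, h1, Int.cast_zero, zero_mul]

end AuxiliaryPolynomial

section RothTheorem

theorem norm_aeval_le {σ : Type*} [Fintype σ] {Q : MvPolynomial σ ℤ} {r : σ → ℕ}
    (hr : ∀ i, degreeOf i Q ≤ r i) {x : σ → ℂ} {a : ℝ} (ha : 1 ≤ a) (hx : ∀ i, ‖x i‖ ≤ a) :
    ‖aeval x Q‖ ≤ len Q * a ^ ∑ i, r i := by
  rw [aeval_def, eval₂_eq', len, Finset.sum_mul]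
  refine norm_sum_le_of_le _ fun I hI => ?_
  rw [norm_mul, norm_prod, algebraMap_int_eq, eq_intCast, Complex.norm_intCast]
  refine mul_le_mul_of_nonneg_left ?_ (abs_nonneg _)
  rw [← Finset.prod_pow_eq_pow_sum]
  refine Finset.prod_le_prod (fun i _ => norm_nonneg _) fun i _ => ?_
  rw [norm_pow]
  exact (pow_le_pow_left₀ (norm_nonneg _) (hx i) _).trans
    (pow_le_pow_right₀ ha (degreeOf_le_iff.mp (hr i) I hI))

theorem hasse_eq_zero_of_degreeOf_lt {σ : Type*} [Fintype σ] {Q : MvPolynomial σ ℤ} {J : σ →₀ ℕ}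
    {i : σ} (h : degreeOf i Q < J i) : hasse ℤ J Q = 0 := by
  rw [hasse_eq_sum]
  refine Finset.sum_eq_zero fun I hI => ?_
  rw [Finset.prod_eq_zero (Finset.mem_univ i), Nat.cast_zero, mul_zero, monomial_zero]
  exact Nat.choose_eq_zero_of_lt ((degreeOf_le_iff.mp le_rfl I hI).trans_lt h)

theorem norm_aeval_le_of_indexGE {m : ℕ} {Q : MvPolynomial (Fin m) ℤ} {r : Fin m → ℕ}
    (hr : ∀ h, 0 < r h) (hdeg : ∀ h, degreeOf h Q ≤ r h) {α : ℂ} {θ : ℝ}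
    (hQ : IndexGE (fun h => 1 / r h) (fun _ => α) θ Q) {a C κ Λ : ℝ} (ha : 1 ≤ a) (hα : ‖α‖ ≤ a)
    (hC : 1 ≤ C) (hκ : 0 ≤ κ) (hΛ : 0 ≤ Λ) {ℓ : Fin m → ℝ} (hℓ : ∀ h, Λ ≤ r h * ℓ h)
    {y : Fin m → ℂ} (hy : ∀ h, ‖y h - α‖ ≤ C * Real.exp (-(κ * ℓ h))) :
    ‖aeval y Q‖ ≤ (4 * a * C) ^ (∑ h, r h) * len Q * Real.exp (-(κ * (Λ * θ))) := by
  classical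
  set R := ∑ h, r h with hR
  set S := shift (fun _ => α) Q with hS
  have h1 : aeval y Q = aeval (fun h => y h - α) S := by
    have h2 : ((aeval (R := ℂ) fun h => y h - α).restrictScalars ℤ).comp
        (shift (R := ℤ) fun _ => α) = aeval y := algHom_ext fun h => by simp [shift]
    rw [← h2]
    rfl
  have hbox : ∀ I ∈ S.support, ∀ h, I h ≤ r h := by
    intro I hI h
    by_contra! hlt
    rw [mem_support_iff, hS, coeff_shift,
      hasse_eq_zero_of_degreeOf_lt ((hdeg h).trans_lt hlt), map_zero] at hI
    exact hI rfl
  have hcard : (S.support.card : ℝ) ≤ 2 ^ R := by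
    have h2 : S.support ⊆ (Fintype.piFinset fun h => Finset.range (r h + 1)).image
        (Finsupp.equivFunOnFinite.symm) := by
      intro I hI
      refine Finset.mem_image.mpr ⟨I, ?_, by ext; simp⟩
      simpa [Fintype.mem_piFinset, Nat.lt_succ_iff] using hbox I hI
    have h3 := (Finset.card_le_card h2).trans Finset.card_image_le
    rw [Fintype.card_piFinset] at h3
    simp only [Finset.card_range] at h3
    have h4 : ∏ h, (r h + 1) ≤ 2 ^ R := by
      rw [hR, ← Finset.prod_pow_eq_pow_sum]
      exact Finset.prod_le_prod' fun h _ => Nat.lt_two_pow_self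
    exact_mod_cast h3.trans h4
  have hterm : ∀ I ∈ S.support, ‖coeff I S * ∏ h, (y h - α) ^ I h‖ ≤
      2 ^ R * len Q * a ^ R * (C ^ R * Real.exp (-(κ * (Λ * θ)))) := by
    intro I hI
    rw [norm_mul]
    refine mul_le_mul ?_ ?_ (norm_nonneg _) ?_
    · rw [hS, coeff_shift]
      exact (norm_aeval_le (fun h => (degreeOf_hasse_le I Q h).trans (hdeg h)) ha fun _ => hα).trans
        (mul_le_mul_of_nonneg_right (len_hasse_le _ hdeg) (by positivity))
    · have hθ : θ ≤ ∑ h, I h * (1 / r h : ℝ) := by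
        by_contra! hlt
        rw [mem_support_iff, hS, coeff_shift] at hI
        exact hI (hQ I hlt)
      have h2 : Λ * θ ≤ ∑ h, I h * ℓ h := by
        refine (mul_le_mul_of_nonneg_left hθ hΛ).trans ?_
        rw [Finset.mul_sum]
        refine Finset.sum_le_sum fun h _ => ?_
        have h3 : (0 : ℝ) < r h := by exact_mod_cast hr h
        calc Λ * (I h * (1 / r h : ℝ)) = I h * (Λ / r h) := by ring
          _ ≤ I h * ℓ h := mul_le_mul_of_nonneg_left
            (by rw [div_le_iff₀ h3, mul_comm]; exact hℓ h) (by positivity)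
      rw [norm_prod]
      calc ∏ h, ‖(y h - α) ^ I h‖ ≤ ∏ h, (C ^ r h * Real.exp (-(κ * (I h * ℓ h)))) := by
            refine Finset.prod_le_prod (fun h _ => norm_nonneg _) fun h _ => ?_
            rw [norm_pow]
            refine (pow_le_pow_left₀ (norm_nonneg _) (hy h) _).trans ?_
            rw [mul_pow, ← Real.exp_nat_mul]
            refine mul_le_mul (pow_le_pow_right₀ hC (hbox I hI h)) (le_of_eq ?_)
              (Real.exp_pos _).le (by positivity)
            ring_nf
        _ = C ^ R * Real.exp (-(κ * ∑ h, I h * ℓ h)) := by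
            rw [Finset.prod_mul_distrib, Finset.prod_pow_eq_pow_sum, ← Real.exp_sum,
              Finset.sum_neg_distrib, Finset.mul_sum]
        _ ≤ _ := by
            refine mul_le_mul_of_nonneg_left (Real.exp_le_exp.mpr (neg_le_neg ?_)) (by positivity)
            exact mul_le_mul_of_nonneg_left h2 hκ
    · have := len_nonneg Q
      positivity
  rw [h1, aeval_def, eval₂_eq']
  refine (norm_sum_le_of_le _ hterm).trans ?_
  rw [Finset.sum_const, nsmul_eq_mul]
  have := len_nonneg Q
  refine (mul_le_mul_of_nonneg_right hcard (by positivity)).trans_eq ?_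
  rw [show (4 * a * C : ℝ) = 2 * 2 * a * C by ring, mul_pow, mul_pow, mul_pow]
  ring

theorem exists_int_aeval_mul_eq {m : ℕ} {Q : MvPolynomial (Fin m) ℤ} {r : Fin m → ℕ}
    (hdeg : ∀ h, degreeOf h Q ≤ r h) (z : Fin m → ℚ) :
    ∃ N : ℤ, aeval z Q * ∏ h, ((z h).den : ℚ) ^ r h = N := by
  refine ⟨∑ I ∈ Q.support, coeff I Q * ∏ h, ((z h).num ^ I h * ((z h).den : ℤ) ^ (r h - I h)), ?_⟩
  rw [aeval_def, eval₂_eq', Finset.sum_mul]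
  push_cast
  refine Finset.sum_congr rfl fun I hI => ?_
  rw [mul_assoc, ← Finset.prod_mul_distrib]
  simp only [algebraMap_int_eq, eq_intCast]
  congr 1
  refine Finset.prod_congr rfl fun h _ => ?_
  have h1 : I h ≤ r h := degreeOf_le_iff.mp (hdeg h) I hI
  rw [← Nat.add_sub_cancel' h1, pow_add, ← mul_assoc, ← mul_pow, Rat.mul_den_eq_num,
    Nat.add_sub_cancel_left]

theorem Rat.finite_setOf_abs_le_den_le (R : ℝ) (D : ℕ) :
    {z : ℚ | |(z : ℝ)| ≤ R ∧ z.den ≤ D}.Finite := by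
  refine Set.Finite.of_finite_image (f := fun z : ℚ => (z.num, z.den)) ?_ ?_
  · refine ((Set.finite_Icc (-⌈R * D⌉) ⌈R * D⌉).prod (Set.finite_Iic D)).subset ?_
    rintro _ ⟨z, ⟨h1, h2⟩, rfl⟩
    refine ⟨?_, h2⟩
    rw [Set.mem_Icc, ← abs_le]
    have h3 : |(z.num : ℝ)| ≤ R * D := by
      have h4 : (z.num : ℝ) = z * z.den := by exact_mod_cast (Rat.mul_den_eq_num z).symm
      rw [h4, abs_mul, Nat.abs_cast]
      exact mul_le_mul h1 (by exact_mod_cast h2) (by positivity) ((abs_nonneg _).trans h1)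
    exact_mod_cast h3.trans (Int.le_ceil _)
  · intro z _ w _ h
    exact Rat.ext (Prod.ext_iff.mp h).1 (Prod.ext_iff.mp h).2

set_option maxHeartbeats 1000000 in
/-- **Roth's theorem** for algebraic integers. -/
theorem roth_of_isIntegral {α : ℂ} (hα : IsIntegral ℤ α) {κ C : ℝ} (hκ : 2 < κ) (hC : 1 ≤ C) :
    {z : ℚ | ‖α - z‖ ≤ C * (z.den : ℝ) ^ (-κ)}.Finite := by
  set S := {z : ℚ | ‖α - z‖ ≤ C * (z.den : ℝ) ^ (-κ)} with hSdef
  by_contra hS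
  have hunbdd : ∀ D : ℕ, ∃ z ∈ S, D < z.den := by
    intro D
    by_contra! h
    refine hS ((Rat.finite_setOf_abs_le_den_le (‖α‖ + C) D).subset fun z hz => ⟨?_, h z hz⟩)
    have h1 : (z.den : ℝ) ^ (-κ) ≤ 1 :=
      Real.rpow_le_one_of_one_le_of_nonpos (by exact_mod_cast z.den_pos) (by linarith)
    have h2 : ‖α - z‖ ≤ C := hz.trans (by nlinarith)
    have h3 : ‖(z : ℂ)‖ ≤ ‖α‖ + ‖α - z‖ := by
      rw [norm_sub_rev, add_comm]
      simpa using norm_add_le (z - α : ℂ) α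
    have h4 : ‖(z : ℂ)‖ = |(z : ℝ)| := by
      rw [← Complex.ofReal_ratCast, Complex.norm_real, Real.norm_eq_abs]
    linarith
  obtain ⟨C₁, d, hC₁, hd, haux⟩ := exists_auxiliary_polynomial hα
  set ε := κ - 2 with hε
  have hε0 : 0 < ε := by linarith
  set δ := ε / (16 * κ) with hδ
  have hδ0 : 0 < δ := by positivity
  have hδκ : κ * δ = ε / 16 := by rw [hδ]; field_simp
  have hδ2 : δ < 1 / 2 := by
    rw [hδ, div_lt_iff₀ (by linarith)]
    linarith
  set ζ := min (ε / 8) 1 with hζ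
  have hζ0 : 0 < ζ := by positivity
  have hζ1 : ζ ≤ 1 := min_le_right _ _
  have hζε : ζ ≤ ε / 8 := min_le_left _ _
  obtain ⟨m, hm0, hm⟩ : ∃ m : ℕ, 0 < m ∧ 2 * d ≤ Real.exp (2 * m * δ ^ 2) := by
    obtain ⟨m, hm⟩ := exists_nat_ge ((2 * d : ℝ) / (2 * δ ^ 2))
    refine ⟨m + 1, m.succ_pos, ?_⟩
    rw [div_le_iff₀ (by positivity)] at hm
    have h1 := Real.add_one_le_exp (2 * (m + 1 : ℕ) * δ ^ 2)
    push_cast at h1 ⊢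
    nlinarith [sq_nonneg δ]
  have hm0' : (0 : ℝ) < m := by exact_mod_cast hm0
  obtain ⟨ω, hω, hroth⟩ := exists_rothLemmaFor m (m * δ) (by positivity)
  set a := max 1 ‖α‖ with ha
  set D := 4 * a * C * 2 * C₁ with hD
  have ha1 : 1 ≤ a := le_max_left _ _
  have hD1 : 1 ≤ D := by
    rw [hD]
    nlinarith [mul_le_mul ha1 hC zero_le_one (by linarith),
      mul_le_mul (mul_le_mul ha1 hC zero_le_one (by linarith)) hC₁ zero_le_one (by nlinarith)]
  obtain ⟨L, hL0, hL1, hL2, hL3⟩ : ∃ L : ℝ, 0 < L ∧ 2 * m * Real.log C₁ ≤ ω * L ∧ 2 ≤ ω * L ∧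
      2 * Real.log D ≤ ζ * L := by
    refine ⟨max (max 1 (2 * m * Real.log C₁ / ω)) (max (2 / ω) (2 * Real.log D / ζ)),
      ?_, ?_, ?_, ?_⟩
    · exact lt_max_of_lt_left (lt_max_of_lt_left one_pos)
    · rw [← div_le_iff₀' hω]
      exact le_max_of_le_left (le_max_right _ _)
    · rw [← div_le_iff₀' hω]
      exact le_max_of_le_right (le_max_left _ _)
    · rw [← div_le_iff₀' hζ0]
      exact le_max_of_le_right (le_max_right _ _)
  have hlarge : ∀ x : ℝ, ∃ z ∈ S, x ≤ Real.log z.den := by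
    intro x
    obtain ⟨z, hz, hzD⟩ := hunbdd ⌈Real.exp x⌉₊
    refine ⟨z, hz, ?_⟩
    rw [Real.le_log_iff_exp_le (by exact_mod_cast z.den_pos)]
    exact (Nat.le_ceil _).trans (by exact_mod_cast hzD.le)
  obtain ⟨f, hf, hfgap⟩ := exists_seq_of_forall_finset_exists
    (fun z : ℚ => z ∈ S ∧ L ≤ Real.log z.den)
    (fun z w => 2 * Real.log z.den ≤ ω * Real.log w.den) (by
      intro s _
      obtain ⟨z, hz, hzx⟩ := hlarge (L + ∑ w ∈ s, |2 * Real.log w.den / ω|)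
      have h0 : 0 ≤ ∑ w ∈ s, |2 * Real.log w.den / ω| := Finset.sum_nonneg fun _ _ => abs_nonneg _
      refine ⟨z, ⟨hz, by linarith⟩, fun w hw => ?_⟩
      rw [← div_le_iff₀' hω]
      have h1 := Finset.single_le_sum (f := fun w : ℚ => |2 * Real.log w.den / ω|)
        (fun _ _ => abs_nonneg _) hw
      have h2 := le_abs_self (2 * Real.log w.den / ω)
      linarith)
  let z : Fin m → ℚ := fun h => f (Fin.rev h)
  let ℓ : Fin m → ℝ := fun h => Real.log (z h).den
  have hzS : ∀ h, z h ∈ S := fun h => (hf _).1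
  have hℓL : ∀ h, L ≤ ℓ h := fun h => (hf _).2
  have hℓgap : ∀ i j, i < j → 2 * ℓ j ≤ ω * ℓ i := fun i j hij =>
    hfgap _ _ (Fin.rev_lt_rev.mpr hij)
  have hℓ0 : ∀ h, 0 < ℓ h := fun h => hL0.trans_le (hℓL h)
  obtain ⟨Λ, hΛ0, hΛ⟩ : ∃ Λ : ℝ, 0 < Λ ∧ ∀ h, ℓ h ≤ ζ * Λ := by
    refine ⟨(∑ h, ℓ h) / ζ + 1, ?_, fun h => ?_⟩
    · have : 0 ≤ ∑ h, ℓ h := Finset.sum_nonneg fun h _ => (hℓ0 h).le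
      positivity
    · have := Finset.single_le_sum (f := ℓ) (fun h _ => (hℓ0 h).le) (Finset.mem_univ h)
      rw [mul_add, mul_div_cancel₀ _ hζ0.ne']
      linarith
  let r : Fin m → ℕ := fun h => ⌈Λ / ℓ h⌉₊
  have hr0 : ∀ h, 0 < r h := fun h => Nat.ceil_pos.mpr (div_pos hΛ0 (hℓ0 h))
  have hrΛ : ∀ h, Λ ≤ r h * ℓ h := fun h => by
    rw [← div_le_iff₀ (hℓ0 h)]
    exact Nat.le_ceil _
  have hrΛ' : ∀ h, r h * ℓ h ≤ (1 + ζ) * Λ := fun h => by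
    have h1 := (Nat.ceil_lt_add_one (div_pos hΛ0 (hℓ0 h)).le).le
    have h2 := mul_le_mul_of_nonneg_right h1 (hℓ0 h).le
    rw [add_mul, div_mul_cancel₀ _ (hℓ0 h).ne'] at h2
    linarith [hΛ h]
  have hrΛ2 : ∀ h, r h * ℓ h ≤ 2 * Λ := fun h => (hrΛ' h).trans (by nlinarith)
  set R := ∑ h, r h with hR
  have hRL : (R : ℝ) * L ≤ 2 * m * Λ := by
    rw [hR, Nat.cast_sum, Finset.sum_mul]
    refine (Finset.sum_le_sum fun h _ => (mul_le_mul_of_nonneg_left (hℓL h)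
      (Nat.cast_nonneg _)).trans (hrΛ2 h)).trans_eq ?_
    simp
    ring
  obtain ⟨P, hP0, hPdeg, hPlen, hPind⟩ := haux m r δ hr0 hδ0 hδ2 hm
  have hlogC₁ : 0 ≤ Real.log C₁ := Real.log_nonneg hC₁
  have hlogD : 0 ≤ Real.log D := Real.log_nonneg hD1
  have hr1 : ∀ i j, i < j → (r i : ℝ) ≤ ω * r j := by
    intro i j hij
    refine le_of_mul_le_mul_right ?_ (hℓ0 i)
    calc r i * ℓ i ≤ 2 * Λ := hrΛ2 i
      _ ≤ r j * (2 * ℓ j) := by linarith [hrΛ j]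
      _ ≤ r j * (ω * ℓ i) := mul_le_mul_of_nonneg_left (hℓgap i j hij) (Nat.cast_nonneg _)
      _ = _ := by ring
  have hr2 : ∀ i, (r i : ℝ) ≤ ω * Λ := by
    intro i
    refine le_of_mul_le_mul_right ?_ hL0
    have := mul_le_mul_of_nonneg_left (hℓL i) (Nat.cast_nonneg (r i) : (0 : ℝ) ≤ _)
    nlinarith [hrΛ2 i]
  have hPlen' : len P ≤ Real.exp (ω * Λ) := by
    refine hPlen.trans ?_
    rw [← Real.exp_log (by linarith : 0 < C₁), ← Real.exp_nat_mul, Real.exp_le_exp]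
    refine le_of_mul_le_mul_right ?_ hL0
    nlinarith [mul_le_mul_of_nonneg_right hRL hlogC₁]
  obtain ⟨J, hJ, hJ0⟩ := hroth r (fun h => (z h).num) (fun h => (z h).den) Λ P hr0 hr1 hr2
    (fun h => (z h).isCoprime_num_den) (fun h => (z h).den_pos) hrΛ hP0 hPdeg hPlen'
  simp_rw [Rat.num_div_den] at hJ0
  have hQdeg : ∀ h, degreeOf h (hasse ℤ J P) ≤ r h := fun h =>
    (degreeOf_hasse_le J P h).trans (hPdeg h)
  have hQlen : len (hasse ℤ J P) ≤ (2 * C₁) ^ R := by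
    rw [mul_pow]
    exact (len_hasse_le J hPdeg).trans (mul_le_mul_of_nonneg_left hPlen (by positivity))
  have hQind : IndexGE (fun h => 1 / r h) (fun _ => α) (m * (1 / 2 - 2 * δ)) (hasse ℤ J P) :=
    (hPind.hasse J).mono (by linarith)
  have hupper := norm_aeval_le_of_indexGE (y := fun h => (z h : ℂ)) hr0 hQdeg hQind ha1
    (le_max_right _ _) hC (by linarith : 0 ≤ κ) hΛ0.le hrΛ (fun h => by
      have h1 : ‖α - z h‖ ≤ C * ((z h).den : ℝ) ^ (-κ) := hzS h
      rw [norm_sub_rev,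
        Real.rpow_def_of_pos (by exact_mod_cast (z h).den_pos)] at h1
      refine h1.trans_eq ?_
      simp only [ℓ]
      ring_nf)
  have hupper' : ‖aeval (fun h => (z h : ℂ)) (hasse ℤ J P)‖ ≤
      Real.exp (R * Real.log D - κ * (Λ * (m * (1 / 2 - 2 * δ)))) := by
    refine hupper.trans ?_
    rw [sub_eq_add_neg (_ * Real.log D), Real.exp_add, Real.exp_nat_mul, Real.exp_log (by linarith)]
    refine mul_le_mul_of_nonneg_right ?_ (Real.exp_pos _).le
    refine (mul_le_mul_of_nonneg_left hQlen (by positivity)).trans_eq ?_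
    have hbase : 4 * a * C * (2 * C₁) = D := by rw [hD]; ring
    rw [← hR, ← hbase, mul_comm, ← mul_pow, mul_comm]
  have hden : ((∏ h, ((z h).den : ℚ) ^ r h : ℚ) : ℝ) ≤ Real.exp (m * ((1 + ζ) * Λ)) := by
    have h1 : ((∏ h, ((z h).den : ℚ) ^ r h : ℚ) : ℝ) = Real.exp (∑ h, r h * ℓ h) := by
      rw [Real.exp_sum]
      push_cast
      refine Finset.prod_congr rfl fun h _ => ?_
      rw [Real.exp_nat_mul, Real.exp_log (by exact_mod_cast (z h).den_pos)]
    rw [h1, Real.exp_le_exp]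
    refine (Finset.sum_le_sum fun h _ => hrΛ' h).trans_eq ?_
    simp
  obtain ⟨N, hN⟩ := exists_int_aeval_mul_eq hQdeg z
  have hN1 : (1 : ℝ) ≤ |(N : ℝ)| := by
    have hN0 : N ≠ 0 := by
      rintro rfl
      rw [Int.cast_zero, mul_eq_zero] at hN
      refine hN.elim hJ0 (Finset.prod_ne_zero_iff.mpr fun h _ => pow_ne_zero _ ?_)
      exact_mod_cast (z h).den_pos.ne'
    exact_mod_cast Int.one_le_abs hN0
  have hnorm : ‖aeval (fun h => (z h : ℂ)) (hasse ℤ J P)‖ =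
      |((aeval z (hasse ℤ J P) : ℚ) : ℝ)| := by
    have h1 : aeval (fun h => (z h : ℂ)) (hasse ℤ J P) = ((aeval z (hasse ℤ J P) : ℚ) : ℂ) :=
      aeval_algebraMap_apply ℂ z (hasse ℤ J P)
    rw [h1, ← Complex.ofReal_ratCast, Complex.norm_real, Real.norm_eq_abs]
  have hprod : |(N : ℝ)| ≤ Real.exp (R * Real.log D - κ * (Λ * (m * (1 / 2 - 2 * δ)))) *
      Real.exp (m * ((1 + ζ) * Λ)) := by
    have h1 : (N : ℝ) = (aeval z (hasse ℤ J P) : ℚ) * ((∏ h, ((z h).den : ℚ) ^ r h : ℚ) : ℝ) := by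
      exact_mod_cast hN.symm
    have h2 : (0 : ℝ) ≤ ((∏ h, ((z h).den : ℚ) ^ r h : ℚ) : ℝ) := by
      exact_mod_cast Finset.prod_nonneg fun h _ => by positivity
    rw [h1, abs_mul, abs_of_nonneg h2, ← hnorm]
    exact mul_le_mul hupper' hden h2 (Real.exp_pos _).le
  have hfinal := hN1.trans hprod
  rw [← Real.exp_add, Real.one_le_exp_iff] at hfinal
  have hRD : R * Real.log D ≤ ζ * (m * Λ) := by
    refine le_of_mul_le_mul_right ?_ hL0
    nlinarith [mul_le_mul_of_nonneg_right hRL hlogD,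
      mul_le_mul_of_nonneg_left hL3 (by positivity : 0 ≤ m * Λ)]
  have hκδ : κ * (Λ * (m * (1 / 2 - 2 * δ))) = (1 + 3 / 8 * ε) * (m * Λ) := by
    have : κ * (1 / 2 - 2 * δ) = 1 + 3 / 8 * ε := by linarith
    rw [← this]
    ring
  have hmΛ : 0 < m * Λ := by positivity
  have hζmΛ := mul_le_mul_of_nonneg_right hζε hmΛ.le
  have hεmΛ : 0 < ε * (m * Λ) := by positivity
  rw [hκδ] at hfinal
  linarith only [hfinal, hRD, hζmΛ, hεmΛ]

/-- **Roth's theorem**. -/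
theorem roth {α : ℂ} (hα : IsAlgebraic ℚ α) {κ C : ℝ} (hκ : 2 < κ) :
    {z : ℚ | ‖α - z‖ ≤ C * (z.den : ℝ) ^ (-κ)}.Finite := by
  obtain ⟨b, hb, hbα⟩ : ∃ b : ℤ, b ≠ 0 ∧ IsIntegral ℤ (b * α) := by
    have h1 : IsAlgebraic ℤ α := (IsFractionRing.isAlgebraic_iff ℤ ℚ ℂ).mpr hα
    obtain ⟨b, hb, h⟩ := h1.exists_integral_multiple
    exact ⟨b, hb, by simpa using h⟩
  refine Set.Finite.of_finite_image (f := fun z : ℚ => b * z)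
    ((roth_of_isIntegral hbα hκ (le_max_left 1 (|(b : ℝ)| * |C|))).subset ?_) ?_
  · rintro _ ⟨z, hz, rfl⟩
    have hden : ((b * z).den : ℝ) ≤ z.den := by
      have : (b * z).den ∣ z.den := by simpa using Rat.mul_den_dvd b z
      exact_mod_cast Nat.le_of_dvd z.den_pos this
    have hpos : (0 : ℝ) < (b * z).den := by exact_mod_cast (b * z).den_pos
    have h2 : (z.den : ℝ) ^ (-κ) ≤ ((b * z).den : ℝ) ^ (-κ) :=
      Real.rpow_le_rpow_of_nonpos hpos hden (by linarith)
    calc ‖(b * α : ℂ) - ((b * z : ℚ) : ℂ)‖ = |(b : ℝ)| * ‖α - z‖ := by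
          rw [Rat.cast_mul, Rat.cast_intCast, ← mul_sub, norm_mul, Complex.norm_intCast]
      _ ≤ |(b : ℝ)| * (C * (z.den : ℝ) ^ (-κ)) := mul_le_mul_of_nonneg_left hz (abs_nonneg _)
      _ ≤ |(b : ℝ)| * (|C| * ((b * z).den : ℝ) ^ (-κ)) := by
          refine mul_le_mul_of_nonneg_left ?_ (abs_nonneg _)
          exact mul_le_mul (le_abs_self C) h2 (by positivity) (abs_nonneg _)
      _ ≤ _ := by
          rw [← mul_assoc]
          exact mul_le_mul_of_nonneg_right (le_max_right _ _) (by positivity)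
  · intro z _ w _ h
    exact mul_left_cancel₀ (Int.cast_ne_zero.mpr hb) h

end RothTheorem

section RationalPointsNearRoots

open Filter Topology

theorem Polynomial.exists_le_norm_eval_or_exists_root {g : Polynomial ℂ} (hg : g ≠ 0) {ν : ℕ}
    (hν : ∀ α, g.rootMultiplicity α ≤ ν) {K : Set ℂ} (hK : IsCompact K) :
    ∃ c > 0, ∀ z ∈ K, c ≤ ‖g.eval z‖ ∨ ∃ α ∈ g.roots, c * ‖z - α‖ ^ ν ≤ ‖g.eval z‖ := by
  refine hK.induction_on (p := fun s => ∃ c > 0, ∀ z ∈ s, c ≤ ‖g.eval z‖ ∨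
    ∃ α ∈ g.roots, c * ‖z - α‖ ^ ν ≤ ‖g.eval z‖) ⟨1, one_pos, by simp⟩ ?_ ?_ ?_
  · rintro s t hst ⟨c, hc, h⟩
    exact ⟨c, hc, fun z hz => h z (hst hz)⟩
  · rintro s t ⟨c, hc, hs⟩ ⟨d, hd, ht⟩
    have hmono : ∀ {e : ℝ} {z : ℂ}, min c d ≤ e → (e ≤ ‖g.eval z‖ ∨
        ∃ α ∈ g.roots, e * ‖z - α‖ ^ ν ≤ ‖g.eval z‖) → (min c d ≤ ‖g.eval z‖ ∨
        ∃ α ∈ g.roots, min c d * ‖z - α‖ ^ ν ≤ ‖g.eval z‖) := by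
      rintro e z he (h | ⟨α, hα, h⟩)
      · exact Or.inl (he.trans h)
      · exact Or.inr ⟨α, hα, (mul_le_mul_of_nonneg_right he (by positivity)).trans h⟩
    refine ⟨min c d, lt_min hc hd, ?_⟩
    rintro z (hz | hz)
    · exact hmono (min_le_left c d) (hs z hz)
    · exact hmono (min_le_right c d) (ht z hz)
  · intro α _
    set m := g.rootMultiplicity α with hm
    obtain ⟨h, hgh, hdvd⟩ := Polynomial.exists_eq_pow_rootMultiplicity_mul_and_not_dvd g hg α
    have hhα : 0 < ‖h.eval α‖ := by
      rw [norm_pos_iff]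
      rwa [Polynomial.dvd_iff_isRoot] at hdvd
    have hcont : Tendsto (fun z => ‖h.eval z‖) (𝓝 α) (𝓝 ‖h.eval α‖) :=
      (h.continuous.norm).tendsto α
    refine ⟨_, mem_nhdsWithin_of_mem_nhds ((hcont.eventually_const_lt (half_lt_self hhα)).and
      (Metric.ball_mem_nhds α one_pos)), ‖h.eval α‖ / 2, half_pos hhα, ?_⟩
    rintro z ⟨hz, hz1⟩
    have hgz : ‖g.eval z‖ = ‖z - α‖ ^ m * ‖h.eval z‖ := by
      conv_lhs => rw [hgh]
      simp [m]
    rw [hgz]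
    rcases Nat.eq_zero_or_pos m with hm0 | hm0
    · left
      rw [hm0, pow_zero, one_mul]
      exact hz.le
    · refine Or.inr ⟨α, ?_, ?_⟩
      · rw [Polynomial.mem_roots hg]
        exact (Polynomial.rootMultiplicity_pos hg).mp hm0
      · rw [mul_comm]
        refine mul_le_mul (pow_le_pow_of_le_one (norm_nonneg _) ?_ (hν α)) hz.le (half_pos hhα).le
          (by positivity)
        rw [← dist_eq_norm]
        exact (Metric.mem_ball.mp hz1).le

theorem le_mul_rpow_of_mul_pow_le {x c A D τ : ℝ} {ν : ℕ} (hν : ν ≠ 0) (hx : 0 ≤ x) (hc : 0 < c)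
    (hA : 0 ≤ A) (hD : 0 < D) (h : c * x ^ ν ≤ A * D ^ (-τ)) :
    x ≤ (A / c) ^ (ν : ℝ)⁻¹ * D ^ (-(τ / ν)) := by
  have h1 : x ^ ν ≤ A / c * D ^ (-τ) := by
    rw [div_mul_eq_mul_div, le_div_iff₀ hc]
    linarith
  have h2 := Real.rpow_le_rpow (by positivity) h1 (by positivity : (0 : ℝ) ≤ (ν : ℝ)⁻¹)
  rwa [Real.pow_rpow_inv_natCast hx hν, Real.mul_rpow (by positivity) (by positivity),
    ← Real.rpow_mul hD.le, neg_mul, ← div_eq_mul_inv] at h2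

/-- Rational numbers of denominator at most `B` are `B⁻²`-separated. -/
theorem Rat.one_le_abs_sub_mul_sq {z w : ℚ} (h : z ≠ w) {B : ℝ} (hz : z.den ≤ B) (hw : w.den ≤ B) :
    1 ≤ |(z : ℝ) - w| * B ^ 2 := by
  have hzpos : (0 : ℝ) < z.den := by exact_mod_cast z.den_pos
  have hwpos : (0 : ℝ) < w.den := by exact_mod_cast w.den_pos
  have hcast : ((z : ℝ) - w) * (z.den * w.den) = ((z.num * w.den - w.num * z.den : ℤ) : ℝ) := by
    have hz' : (z : ℝ) = z.num / z.den := Rat.cast_def z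
    have hw' : (w : ℝ) = w.num / w.den := Rat.cast_def w
    rw [hz', hw']
    push_cast
    field_simp
  have hne : (z.num * w.den - w.num * z.den : ℤ) ≠ 0 := by
    intro h0
    rw [h0, Int.cast_zero, mul_eq_zero, or_iff_left (by positivity), sub_eq_zero] at hcast
    exact h (by exact_mod_cast hcast)
  have h1 : (1 : ℝ) ≤ |((z.num * w.den - w.num * z.den : ℤ) : ℝ)| := by
    exact_mod_cast Int.one_le_abs hne
  rw [← hcast, abs_mul, abs_of_pos (mul_pos hzpos hwpos)] at h1
  refine h1.trans (mul_le_mul_of_nonneg_left ?_ (abs_nonneg _))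
  rw [sq]
  exact mul_le_mul hz hw hwpos.le (hzpos.le.trans hz)

theorem Rat.ncard_setOf_den_le_near (α : ℂ) {B r : ℝ} (hr : 0 ≤ r) :
    {z : ℚ | z.den ≤ B ∧ ‖(z : ℂ) - α‖ ≤ r}.Finite ∧
      ({z : ℚ | z.den ≤ B ∧ ‖(z : ℂ) - α‖ ≤ r}.ncard : ℝ) ≤ 2 * r * B ^ 2 + 1 := by
  set S := {z : ℚ | z.den ≤ B ∧ ‖(z : ℂ) - α‖ ≤ r} with hS
  set f : ℚ → ℤ := fun z => ⌊((z : ℝ) - (α.re - r)) * B ^ 2⌋ with hf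
  have hmaps : Set.MapsTo f S (Finset.Icc 0 ⌊2 * r * B ^ 2⌋ : Finset ℤ) := by
    rintro z ⟨-, hz⟩
    have h1 : |(z : ℝ) - α.re| ≤ r := by
      refine le_trans ?_ hz
      simpa using Complex.abs_re_le_norm ((z : ℂ) - α)
    rw [abs_le] at h1
    rw [Finset.mem_coe, Finset.mem_Icc]
    constructor
    · rw [hf, Int.floor_nonneg]
      exact mul_nonneg (by linarith) (by positivity)
    · exact Int.floor_le_floor (mul_le_mul_of_nonneg_right (by linarith) (by positivity))
  have hinj : Set.InjOn f S := by
    rintro z ⟨hz, -⟩ w ⟨hw, -⟩ hzw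
    by_contra hne
    have h1 := Rat.one_le_abs_sub_mul_sq hne hz hw
    have h2 := Int.abs_sub_lt_one_of_floor_eq_floor hzw
    rw [← sub_mul, sub_sub_sub_cancel_right, abs_mul, abs_of_nonneg (sq_nonneg B)] at h2
    linarith
  refine ⟨Set.Finite.of_injOn hmaps hinj (Finset.finite_toSet _), ?_⟩
  have hcard := Set.ncard_le_ncard_of_injOn f hmaps hinj (Finset.finite_toSet _)
  rw [Set.ncard_coe_finset, Int.card_Icc] at hcard
  have h0 : (0 : ℤ) ≤ ⌊2 * r * B ^ 2⌋ := Int.floor_nonneg.mpr (by positivity)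
  have h1 : (S.ncard : ℤ) ≤ ⌊2 * r * B ^ 2⌋ + 1 := by omega
  have h2 : (S.ncard : ℝ) ≤ ⌊2 * r * B ^ 2⌋ + 1 := by exact_mod_cast h1
  linarith [Int.floor_le (2 * r * B ^ 2)]

theorem le_rpow_of_le_mul_rpow {c A D τ : ℝ} (hc : 0 < c) (hτ : 0 < τ) (hD : 0 < D)
    (h : c ≤ A * D ^ (-τ)) : D ≤ (A / c) ^ τ⁻¹ := by
  have h1 : D ^ τ ≤ A / c := by
    rw [Real.rpow_neg hD.le, ← div_eq_mul_inv, le_div_iff₀ (by positivity)] at h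
    rw [le_div_iff₀ hc]
    linarith
  have h2 := Real.rpow_le_rpow (by positivity) h1 (inv_pos.mpr hτ).le
  rwa [Real.rpow_rpow_inv hD.le hτ.ne'] at h2

theorem Polynomial.isAlgebraic_of_mem_roots_of_infinite {g : Polynomial ℂ} {W : Set ℚ}
    (hW : W.Infinite) (hg : ∀ z ∈ W, ∃ q : ℚ, g.eval (z : ℂ) = q) {α : ℂ} (hα : α ∈ g.roots) :
    IsAlgebraic ℚ α := by
  obtain ⟨s, hs, hcard⟩ := hW.exists_subset_card_eq (g.natDegree + 1)
  choose! q hq using hg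
  set Q := Lagrange.interpolate s id q with hQ
  have hinj : Set.InjOn (Rat.cast : ℚ → ℂ) s := Rat.cast_injective.injOn
  have hgQ : Q.map (algebraMap ℚ ℂ) = g := by
    refine Polynomial.eq_of_degrees_lt_of_eval_index_eq s hinj ?_ ?_ fun z hz => ?_
    · rw [Polynomial.degree_map]
      exact Lagrange.degree_interpolate_lt q Function.injective_id.injOn
    · rw [hcard]
      exact Polynomial.degree_le_natDegree.trans_lt (by exact_mod_cast Nat.lt_succ_self _)
    · have h1 : Q.eval z = q z :=
        Lagrange.eval_interpolate_at_node q Function.injective_id.injOn hz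
      rw [hq z (hs hz), ← h1, ← eq_ratCast (algebraMap ℚ ℂ) z, Polynomial.eval_map_apply]
      simp
  refine ⟨Q, ?_, ?_⟩
  · rintro h0
    rw [h0, Polynomial.map_zero] at hgQ
    rw [← hgQ] at hα
    simp at hα
  · rw [← Polynomial.eval_map_algebraMap, hgQ]
    exact Polynomial.isRoot_of_mem_roots hα

theorem Polynomial.finite_rat_setOf_norm_eval_le {g : Polynomial ℂ} (hg : g ≠ 0) {ν : ℕ}
    (hν0 : ν ≠ 0) (hν : ∀ α, g.rootMultiplicity α ≤ ν) {W : Set ℚ}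
    (hW : ∀ z ∈ W, ∃ q : ℚ, g.eval (z : ℂ) = q) {A τ : ℝ} (hA : 0 ≤ A) (hτ : 2 < τ / ν) :
    {z ∈ W | |(z : ℝ)| ≤ 1 ∧ ‖g.eval (z : ℂ)‖ ≤ A * (z.den : ℝ) ^ (-τ)}.Finite := by
  rcases W.finite_or_infinite with hfin | hinf
  · exact hfin.subset (Set.sep_subset _ _)
  have hτ0 : 0 < τ := by
    by_contra! h
    linarith [div_nonpos_of_nonpos_of_nonneg h (Nat.cast_nonneg (α := ℝ) ν)]
  obtain ⟨c, hc, hcz⟩ := g.exists_le_norm_eval_or_exists_root hg hν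
    (isCompact_closedBall (0 : ℂ) 1)
  refine ((Rat.finite_setOf_abs_le_den_le 1 ⌊(A / c) ^ τ⁻¹⌋₊).union
    (g.roots.toFinset.finite_toSet.biUnion (t := fun α => {z : ℚ | ‖α - z‖ ≤
      (A / c) ^ (ν : ℝ)⁻¹ * (z.den : ℝ) ^ (-(τ / ν))}) fun α hα => roth
      (isAlgebraic_of_mem_roots_of_infinite hinf hW (by simpa using hα)) hτ)).subset ?_
  rintro z ⟨-, hz1, hz⟩
  have hden : (0 : ℝ) < z.den := by exact_mod_cast z.den_pos
  rcases hcz z (by simpa using hz1) with h | ⟨α, hα, h⟩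
  · refine Or.inl ⟨hz1, Nat.le_floor ?_⟩
    exact le_rpow_of_le_mul_rpow hc hτ0 hden (h.trans hz)
  · refine Or.inr (Set.mem_biUnion (x := α) (by simpa using hα) ?_)
    rw [Set.mem_ofPred_eq, norm_sub_rev]
    exact le_mul_rpow_of_mul_pow_le hν0 (norm_nonneg _) hc hA hden (h.trans hz)

theorem Polynomial.exists_ncard_rat_setOf_norm_eval_le {g : Polynomial ℂ} (hg : g ≠ 0) {ν : ℕ}
    (hν0 : ν ≠ 0) (hν : ∀ α, g.rootMultiplicity α ≤ ν) {A τ : ℝ} (hA : 0 ≤ A) (hτ : 0 < τ) :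
    ∃ C, 0 ≤ C ∧ ∀ B : ℝ, 1 ≤ B →
      {z : ℚ | z.den ≤ B ∧ |(z : ℝ)| ≤ 1 ∧ ‖g.eval (z : ℂ)‖ ≤ A * B ^ (-τ)}.Finite ∧
      ({z : ℚ | z.den ≤ B ∧ |(z : ℝ)| ≤ 1 ∧ ‖g.eval (z : ℂ)‖ ≤ A * B ^ (-τ)}.ncard : ℝ) ≤
        C * (1 + B ^ (2 - τ / ν)) := by
  obtain ⟨c, hc, hcz⟩ := g.exists_le_norm_eval_or_exists_root hg hν
    (isCompact_closedBall (0 : ℂ) 1)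
  set N := {z : ℚ | |(z : ℝ)| ≤ 1 ∧ z.den ≤ ⌊(A / c) ^ τ⁻¹⌋₊} with hN
  have hNfin : N.Finite := Rat.finite_setOf_abs_le_den_le 1 ⌊(A / c) ^ τ⁻¹⌋₊
  set c₁ := (A / c) ^ (ν : ℝ)⁻¹ with hc₁
  have hc₁0 : 0 ≤ c₁ := by positivity
  refine ⟨N.ncard + g.roots.toFinset.card * (2 * c₁ + 1), by positivity, fun B hB => ?_⟩
  have hB0 : 0 < B := one_pos.trans_le hB
  set S := {z : ℚ | z.den ≤ B ∧ |(z : ℝ)| ≤ 1 ∧ ‖g.eval (z : ℂ)‖ ≤ A * B ^ (-τ)} with hS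
  have hr0 : 0 ≤ c₁ * B ^ (-(τ / ν)) := by positivity
  set T := fun α : ℂ => {z : ℚ | z.den ≤ B ∧ ‖(z : ℂ) - α‖ ≤ c₁ * B ^ (-(τ / ν))} with hT
  have hsub : S ⊆ N ∪ ⋃ α ∈ g.roots.toFinset, T α := by
    rintro z ⟨hzB, hz1, hz⟩
    rcases hcz z (by simpa using hz1) with h | ⟨α, hα, h⟩
    · refine Or.inl ⟨hz1, Nat.le_floor ?_⟩
      exact hzB.trans (le_rpow_of_le_mul_rpow hc hτ hB0 (h.trans hz))
    · refine Or.inr (Set.mem_biUnion (x := α) (by simpa using hα) ⟨hzB, ?_⟩)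
      exact le_mul_rpow_of_mul_pow_le hν0 (norm_nonneg _) hc hA hB0 (h.trans hz)
  have hfin : (N ∪ ⋃ α ∈ g.roots.toFinset, T α).Finite :=
    hNfin.union (g.roots.toFinset.finite_toSet.biUnion fun α _ =>
      (Rat.ncard_setOf_den_le_near α hr0).1)
  refine ⟨hfin.subset hsub, ?_⟩
  have h1 : S.ncard ≤ N.ncard + ∑ α ∈ g.roots.toFinset, (T α).ncard :=
    (Set.ncard_le_ncard hsub hfin).trans ((Set.ncard_union_le _ _).trans
      (add_le_add_right (Finset.set_ncard_biUnion_le _ _) _))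
  have hE : 0 ≤ B ^ (2 - τ / ν) := by positivity
  have h2 : ∀ α, ((T α).ncard : ℝ) ≤ (2 * c₁ + 1) * (1 + B ^ (2 - τ / ν)) := by
    intro α
    refine (Rat.ncard_setOf_den_le_near α hr0).2.trans ?_
    have h3 : B ^ (-(τ / ν)) * B ^ 2 = B ^ (2 - τ / ν) := by
      rw [← Real.rpow_natCast, ← Real.rpow_add hB0]
      congr 1
      push_cast
      ring
    have h4 : 2 * (c₁ * B ^ (-(τ / ν))) * B ^ 2 = 2 * c₁ * B ^ (2 - τ / ν) := by
      rw [← h3]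
      ring
    rw [h4]
    nlinarith
  calc (S.ncard : ℝ) ≤ N.ncard + ∑ α ∈ g.roots.toFinset, ((T α).ncard : ℝ) := by exact_mod_cast h1
    _ ≤ N.ncard + ∑ α ∈ g.roots.toFinset, (2 * c₁ + 1) * (1 + B ^ (2 - τ / ν)) :=
      add_le_add_right (Finset.sum_le_sum fun α _ => h2 α) _
    _ ≤ _ := by
      rw [Finset.sum_const, nsmul_eq_mul, ← mul_assoc, add_mul]
      refine add_le_add_left ?_ _
      exact le_mul_of_one_le_right (Nat.cast_nonneg _) (by linarith)

end RationalPointsNearRoots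

section InflectionTangents

open Filter Topology ContDiff

theorem hasDerivAt_aeval {σ : Type*} [Fintype σ] (F : MvPolynomial σ ℤ) {c : ℂ → σ → ℂ}
    {c' : σ → ℂ} {s : ℂ} (hc : ∀ i, HasDerivAt (fun s => c s i) (c' i) s) :
    HasDerivAt (fun s => aeval (c s) F) (∑ i, c' i * aeval (c s) (pderiv i F)) s := by
  classical
  induction F using MvPolynomial.induction_on with
  | C a => simpa using hasDerivAt_const s (a : ℂ)
  | add p q hp hq => simpa [mul_add, Finset.sum_add_distrib] using hp.fun_add hq
  | mul_X p n hp =>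
    have h := hp.fun_mul (hc n)
    simp_rw [map_mul, aeval_X]
    refine h.congr_deriv (Eq.symm ?_)
    simp only [Derivation.leibniz, pderiv_X, smul_eq_mul, map_add, map_mul, aeval_X, mul_add,
      Finset.sum_add_distrib, Pi.single_apply, Finset.sum_mul]
    rw [add_comm]
    congr 1
    · exact Finset.sum_congr rfl fun i _ => by ring
    · rw [Finset.sum_eq_single n (fun i _ hi => by simp [hi.symm]) (by simp)]
      simp
      ring

theorem aeval_smul_of_isHomogeneous {σ : Type*} [Fintype σ] {F : MvPolynomial σ ℤ} {k : ℕ}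
    (hF : F.IsHomogeneous k) (c : ℂ) (p : σ → ℂ) : aeval (c • p) F = c ^ k * aeval p F := by
  rw [aeval_def, aeval_def, eval₂_eq', eval₂_eq', Finset.mul_sum]
  refine Finset.sum_congr rfl fun d hd => ?_
  have hdk : ∑ i, d i = k := by
    rw [← hF (mem_support_iff.mp hd), Finsupp.weight_apply, Finsupp.sum_fintype _ _ (by simp)]
    simp
  simp_rw [Pi.smul_apply, smul_eq_mul, mul_pow, Finset.prod_mul_distrib, Finset.prod_pow_eq_pow_sum,
    hdk]
  ring

/-- Euler's identity, evaluated at a point. -/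
theorem sum_mul_aeval_pderiv {σ : Type*} [Fintype σ]
    {F : MvPolynomial σ ℤ} {k : ℕ} (hF : F.IsHomogeneous k) (p : σ → ℂ) :
    ∑ i, p i * aeval p (pderiv i F) = k * aeval p F := by
  simpa using congrArg (aeval p) hF.sum_X_mul_pderiv

/-- The plane in `ℂ³` underlying the tangent line to `F = 0` at `p`. -/
def tangentPlane (F : MvPolynomial (Fin 3) ℤ) (p : Fin 3 → ℂ) : Set (Fin 3 → ℂ) :=
  {x | ∑ i, x i * aeval p (pderiv i F) = 0}

/-- The Hessian of `F` at `p`, as a bilinear form. -/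
noncomputable def hessian (F : MvPolynomial (Fin 3) ℤ) (p x y : Fin 3 → ℂ) : ℂ :=
  ∑ i, y i * ∑ j, x j * aeval p (pderiv j (pderiv i F))

/-- `F` vanishes to order at least three along the direction `v` at `p`. -/
def IsFlex (F : MvPolynomial (Fin 3) ℤ) (p v : Fin 3 → ℂ) : Prop :=
  aeval p F = 0 ∧ (∀ c : ℂ, v ≠ c • p) ∧ v ∈ tangentPlane F p ∧ hessian F p v v = 0

/-- The restriction of `F` to the line `t ↦ p + t v`. -/
noncomputable def lineRestrict (F : MvPolynomial (Fin 3) ℤ) (p v : Fin 3 → ℂ) : Polynomial ℂ :=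
  aeval (fun i => Polynomial.C (p i) + Polynomial.C (v i) * Polynomial.X) F

theorem eval_lineRestrict (F : MvPolynomial (Fin 3) ℤ) (p v : Fin 3 → ℂ) (t : ℂ) :
    (lineRestrict F p v).eval t = aeval (p + t • v) F := by
  refine (MvPolynomial.comp_aeval_apply _ (Polynomial.evalRingHom t).toIntAlgHom F).trans ?_
  refine congrArg (fun c : Fin 3 → ℂ => aeval c F) (funext fun i => ?_)
  simp [mul_comm t]

theorem hasDerivAt_aeval_line (F : MvPolynomial (Fin 3) ℤ) (p v : Fin 3 → ℂ) (t : ℂ) :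
    HasDerivAt (fun s : ℂ => aeval (p + s • v) F)
      (∑ i, v i * aeval (p + t • v) (pderiv i F)) t :=
  hasDerivAt_aeval F fun i => by
    simpa using ((hasDerivAt_id t).mul_const (v i)).const_add (p i)

theorem eval_derivative_lineRestrict (F : MvPolynomial (Fin 3) ℤ) (p v : Fin 3 → ℂ) (t : ℂ) :
    (lineRestrict F p v).derivative.eval t = ∑ i, v i * aeval (p + t • v) (pderiv i F) := by
  refine ((lineRestrict F p v).hasDerivAt t).unique ?_
  refine (hasDerivAt_aeval_line F p v t).congr_of_eventuallyEq (Eventually.of_forall fun s => ?_)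
  exact eval_lineRestrict F p v s

theorem rootMultiplicity_lineRestrict (F : MvPolynomial (Fin 3) ℤ) (p v : Fin 3 → ℂ) (t : ℂ) :
    (lineRestrict F p v).rootMultiplicity t = contactOrder F (p + t • v) v := by
  rw [Polynomial.rootMultiplicity_eq_rootMultiplicity]
  change _ = (lineRestrict F (p + t • v) v).rootMultiplicity 0
  congr 1
  refine Polynomial.funext fun s => ?_
  rw [Polynomial.eval_comp, eval_lineRestrict, eval_lineRestrict]
  refine congrArg (fun c : Fin 3 → ℂ => aeval c F) ?_
  rw [Polynomial.eval_add, Polynomial.eval_X, Polynomial.eval_C]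
  module

theorem IsInflTangent.isFlex {F : MvPolynomial (Fin 3) ℤ} {p v : Fin 3 → ℂ}
    (h : IsInflTangent F p v) : IsFlex F p v := by
  obtain ⟨-, h0, hv, h1, h3⟩ := h
  refine ⟨h0, hv, h1, ?_⟩
  set Q := lineRestrict F p v with hQ
  have hQ2 : Q.derivative.derivative.eval 0 = hessian F p v v := by
    refine (Q.derivative.hasDerivAt 0).unique ?_
    rw [funext (eval_derivative_lineRestrict F p v)]
    have := HasDerivAt.fun_sum (u := Finset.univ) fun i _ =>
      (hasDerivAt_aeval_line (pderiv i F) p v 0).const_mul (v i)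
    simpa [hessian] using this
  rw [← hQ2]
  have hdvd : Polynomial.X ^ 3 ∣ Q := by
    have := pow_dvd_pow (Polynomial.X - Polynomial.C (0 : ℂ)) h3
    simpa using this.trans (Polynomial.pow_rootMultiplicity_dvd Q 0)
  obtain ⟨S, hS⟩ := hdvd
  rw [hS]
  simp

theorem tangentPlane_smul {F : MvPolynomial (Fin 3) ℤ} {k : ℕ} (hF : F.IsHomogeneous k)
    {c : ℂ} (hc : c ≠ 0) (p : Fin 3 → ℂ) : tangentPlane F (c • p) = tangentPlane F p := by
  ext x
  have h : ∀ i, aeval (c • p) (pderiv i F) = c ^ (k - 1) * aeval p (pderiv i F) := fun i =>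
    aeval_smul_of_isHomogeneous hF.pderiv c p
  simp only [tangentPlane, Set.mem_ofPred_eq, h, mul_left_comm _ (c ^ (k - 1)), ← Finset.mul_sum,
    mul_eq_zero, pow_eq_zero_iff', hc, false_and, false_or]

theorem IsFlex.smul {F : MvPolynomial (Fin 3) ℤ} {k : ℕ} (hF : F.IsHomogeneous k)
    {c : ℂ} (hc : c ≠ 0) {p v : Fin 3 → ℂ} (h : IsFlex F p v) : IsFlex F (c • p) v := by
  obtain ⟨h0, hv, h1, h2⟩ := h
  refine ⟨by rw [aeval_smul_of_isHomogeneous hF, h0, mul_zero], fun d => ?_,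
    by rwa [tangentPlane_smul hF hc], ?_⟩
  · rw [smul_smul]
    exact hv _
  · have h : ∀ i j, aeval (c • p) (pderiv j (pderiv i F)) =
        c ^ (k - 1 - 1) * aeval p (pderiv j (pderiv i F)) := fun i j =>
      aeval_smul_of_isHomogeneous hF.pderiv.pderiv c p
    rw [hessian] at h2 ⊢
    simp only [h, mul_left_comm _ (c ^ (k - 1 - 1)), ← Finset.mul_sum, h2, mul_zero]

open Filter Topology ContDiff

theorem Fin.sum_univ_eq_of_ne {M : Type*} [AddCommMonoid M] {i j l : Fin 3} (hij : i ≠ j)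
    (hil : i ≠ l) (hjl : j ≠ l) (f : Fin 3 → M) : ∑ n, f n = f i + f j + f l := by
  have h : (Finset.univ : Finset (Fin 3)) = {i, j, l} := by
    refine (Finset.eq_univ_of_card _ ?_).symm
    simp [hij, hil, hjl]
  rw [h, Finset.sum_insert (by simp [hij, hil]), Finset.sum_insert (by simp [hjl]),
    Finset.sum_singleton, add_assoc]

theorem pderiv_comm {σ R : Type*} [CommRing R] (i j : σ) (P : MvPolynomial σ R) :
    pderiv i (pderiv j P) = pderiv j (pderiv i P) := by
  classical
  have h : (⁅pderiv i, pderiv j⁆ : Derivation R (MvPolynomial σ R) (MvPolynomial σ R)) = 0 :=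
    derivation_ext fun n => by
      rw [Derivation.commutator_apply]
      simp [pderiv_X, Pi.single_apply, apply_ite]
  have hP := congrArg (fun D => D P) h
  rw [Derivation.commutator_apply] at hP
  simpa [sub_eq_zero] using hP

/-- The point with `i`-th coordinate `t`, `j`-th coordinate `1`, and third coordinate `s`. -/
def affineChart (i j : Fin 3) (s t : ℂ) : Fin 3 → ℂ :=
  fun n => if n = i then t else if n = j then 1 else s

theorem exists_implicit_function {F : MvPolynomial (Fin 3) ℤ} {i j : Fin 3} {s₀ t₀ : ℂ}
    (h0 : aeval (affineChart i j s₀ t₀) F = 0)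
    (hi : aeval (affineChart i j s₀ t₀) (pderiv i F) ≠ 0) :
    ∃ f : ℂ → ℂ, f s₀ = t₀ ∧ AnalyticAt ℂ f s₀ ∧
      (∀ᶠ s in 𝓝 s₀, aeval (affineChart i j s (f s)) F = 0) ∧
      ∀ᶠ q in 𝓝 (s₀, t₀), aeval (affineChart i j q.1 q.2) F = 0 → q.2 = f q.1 := by
  set φ : ℂ × ℂ → ℂ := fun q => aeval (affineChart i j q.1 q.2) F with hφ
  have hφan : ContDiffAt ℂ ω φ (s₀, t₀) := by
    refine AnalyticAt.contDiffAt (AnalyticAt.aeval_mvPolynomial (fun n => ?_) F)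
    unfold affineChart
    split_ifs
    · exact analyticAt_snd
    · exact analyticAt_const
    · exact analyticAt_fst
  have hφt : HasDerivAt (fun t => φ (s₀, t)) (aeval (affineChart i j s₀ t₀) (pderiv i F)) t₀ := by
    refine (hasDerivAt_aeval F (c := fun t => affineChart i j s₀ t) (c' := Pi.single i 1)
      fun n => ?_).congr_deriv ?_
    · unfold affineChart
      by_cases hn : n = i
      · subst hn
        simpa using hasDerivAt_id' t₀
      · simpa [hn] using hasDerivAt_const t₀ _
    · simp [Pi.single_apply]
  have hinv : (fderiv ℂ φ (s₀, t₀) ∘L .inr ℂ ℂ ℂ).IsInvertible := by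
    refine ⟨ContinuousLinearEquiv.unitsEquivAut ℂ (Units.mk0 _ hi), ?_⟩
    have h1 := (hφan.differentiableAt (by simp)).hasFDerivAt
    have h2 : HasDerivAt (fun t : ℂ => (s₀, t)) ((0 : ℂ), (1 : ℂ)) t₀ :=
      (hasDerivAt_const t₀ s₀).prodMk (hasDerivAt_id t₀)
    have h3 := (h1.comp_hasDerivAt t₀ h2).unique hφt
    ext
    simp [← h3]
  refine ⟨hφan.implicitFunction (by simp) hinv, hφan.implicitFunction_apply_self (by simp) hinv,
    (hφan.contDiffAt_implicitFunction (by simp) hinv).analyticAt, ?_, ?_⟩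
  · filter_upwards [hφan.eventually_apply_implicitFunction (by simp) hinv] with s hs
    exact hs.trans h0
  · filter_upwards [hφan.eventually_apply_eq_iff_implicitFunction (by simp) hinv] with q hq h
    exact (hq.mp (h.trans h0.symm)).symm

/-- At a flex of the graph of `f`, the second derivative of `f` vanishes. -/
theorem eventually_deriv_deriv_eq_zero {F : MvPolynomial (Fin 3) ℤ} {k : ℕ}
    (hF : F.IsHomogeneous k) {i j l : Fin 3} (hij : i ≠ j)
    (hil : i ≠ l) (hjl : j ≠ l) {f : ℂ → ℂ} {s₀ : ℂ} (hf : AnalyticAt ℂ f s₀)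
    (h0 : ∀ᶠ s in 𝓝 s₀, aeval (affineChart i j s (f s)) F = 0)
    (hi : aeval (affineChart i j s₀ (f s₀)) (pderiv i F) ≠ 0) :
    ∀ᶠ s in 𝓝 s₀, aeval (affineChart i j s (f s)) (pderiv i F) ≠ 0 ∧
      deriv f s * aeval (affineChart i j s (f s)) (pderiv i F) +
        aeval (affineChart i j s (f s)) (pderiv l F) = 0 ∧
      ∀ v, IsFlex F (affineChart i j s (f s)) v → deriv (deriv f) s = 0 := by
  set c : ℂ → Fin 3 → ℂ := fun s => affineChart i j s (f s) with hc
  have hci : ∀ s, c s i = f s := fun s => if_pos rfl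
  have hcj : ∀ s, c s j = 1 := fun s => (if_neg hij.symm).trans (if_pos rfl)
  have hcl : ∀ s, c s l = s := fun s => (if_neg hil.symm).trans (if_neg hjl.symm)
  have hsum : ∀ g : Fin 3 → ℂ, ∑ n, g n = g i + g j + g l := Fin.sum_univ_eq_of_ne hij hil hjl
  have hderiv : ∀ (G : MvPolynomial (Fin 3) ℤ) (s : ℂ), DifferentiableAt ℂ f s →
      HasDerivAt (fun s => aeval (c s) G)
        (deriv f s * aeval (c s) (pderiv i G) + aeval (c s) (pderiv l G)) s := by
    intro G s hs
    refine (hasDerivAt_aeval G (c := c)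
      (c' := fun n => if n = i then deriv f s else if n = j then 0 else 1) fun n => ?_).congr_deriv
        ?_
    · simp only [hc, affineChart]
      split_ifs
      · exact hs.hasDerivAt
      · exact hasDerivAt_const s 1
      · exact hasDerivAt_id' s
    · rw [hsum]
      simp [hij.symm, hil.symm, hjl.symm]
  have hdiff : ∀ᶠ s in 𝓝 s₀, DifferentiableAt ℂ f s :=
    hf.eventually_analyticAt.mono fun s hs => hs.differentiableAt
  have hdiff' : ∀ᶠ s in 𝓝 s₀, DifferentiableAt ℂ (deriv f) s :=
    hf.deriv.eventually_analyticAt.mono fun s hs => hs.differentiableAt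
  have hE1 : ∀ᶠ s in 𝓝 s₀,
      deriv f s * aeval (c s) (pderiv i F) + aeval (c s) (pderiv l F) = 0 := by
    filter_upwards [h0.eventually_nhds, hdiff] with s hs hd
    exact (hderiv F s hd).unique ((hasDerivAt_const s (0 : ℂ)).congr_of_eventuallyEq hs)
  have hne : ∀ᶠ s in 𝓝 s₀, aeval (c s) (pderiv i F) ≠ 0 :=
    (hderiv _ s₀ hf.differentiableAt).continuousAt.eventually_ne hi
  filter_upwards [h0, hE1, hE1.eventually_nhds, hne, hdiff, hdiff']
    with s h0 hE1 hE1' hne hd hd'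
  refine ⟨hne, hE1, ?_⟩
  rintro v ⟨-, hv, htan, hhess⟩
  have hE2 := ((hd'.hasDerivAt.fun_mul (hderiv (pderiv i F) s hd)).fun_add
    (hderiv (pderiv l F) s hd)).unique ((hasDerivAt_const s (0 : ℂ)).congr_of_eventuallyEq hE1')
  have hEu := sum_mul_aeval_pderiv hF (c s)
  have hEu' : ∀ n, _ := fun n => sum_mul_aeval_pderiv (hF.pderiv (i := n)) (c s)
  change aeval (c s) F = 0 at h0
  change ∑ n, v n * aeval (c s) (pderiv n F) = 0 at htan
  change hessian F (c s) v v = 0 at hhess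
  rw [hsum, hci, hcj, hcl, h0] at hEu
  simp_rw [hsum, hci, hcj, hcl] at hEu'
  rw [hsum] at htan
  simp_rw [hessian, hsum] at hhess
  set b := v l - v j * s with hb
  have hvl : v l = v j * s + b := by rw [hb]; ring
  have hvi : v i = v j * f s + b * deriv f s := by
    refine mul_right_cancel₀ hne ?_
    linear_combination htan - v j * hEu - b * hE1
  have hb0 : b ≠ 0 := by
    intro hb0
    refine hv (v j) (funext fun n => ?_)
    change v n = v j * c s n
    have : n = i ∨ n = j ∨ n = l := by
      revert hij hil hjl
      clear * -
      revert i j l n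
      decide
    rcases this with rfl | rfl | rfl
    · rw [hci, hvi, hb0, zero_mul, add_zero]
    · rw [hcj, mul_one]
    · rw [hcl, hvl, hb0, add_zero]
  have h : b ^ 2 * aeval (c s) (pderiv i F) * deriv (deriv f) s = 0 := by
    have hi' := hEu' i
    have hj' := hEu' j
    have hl' := hEu' l
    simp only [pderiv_comm j i, pderiv_comm l i, pderiv_comm l j] at hi' hj' hl' hE2 hhess
    rw [hvi, hvl] at hhess htan
    linear_combination b ^ 2 * hE2 - hhess + v j * (v j * f s + b * deriv f s) * hi' +
      v j * v j * hj' + v j * (v j * s + b) * hl' + v j * ((k - 1 : ℕ) : ℂ) * htan +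
      v j * b * (deriv f s * hi' + hl') + v j * b * ((k - 1 : ℕ) : ℂ) * hE1
  exact (mul_eq_zero.mp h).resolve_left (mul_ne_zero (pow_ne_zero _ hb0) hne)

open Filter Topology ContDiff

theorem exists_eventually_tangentPlane_eq {F : MvPolynomial (Fin 3) ℤ} {k : ℕ}
    (hF : F.IsHomogeneous k) {i j l : Fin 3} (hij : i ≠ j) (hil : i ≠ l) (hjl : j ≠ l)
    {s₀ t₀ : ℂ} (h0 : aeval (affineChart i j s₀ t₀) F = 0)
    (hi : aeval (affineChart i j s₀ t₀) (pderiv i F) ≠ 0) :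
    ∃ T, ∀ᶠ q in 𝓝 (s₀, t₀), ∀ v, IsFlex F (affineChart i j q.1 q.2) v →
      tangentPlane F (affineChart i j q.1 q.2) = T := by
  obtain ⟨f, rfl, hf, hf0, hfu⟩ := exists_implicit_function h0 hi
  have hev := eventually_deriv_deriv_eq_zero hF hij hil hjl hf hf0 hi
  have hfst : Tendsto (Prod.fst : ℂ × ℂ → ℂ) (𝓝 (s₀, f s₀)) (𝓝 s₀) := continuous_fst.tendsto _
  rcases hf.deriv.deriv.eventually_eq_zero_or_eventually_ne_zero with hzero | hne
  · obtain ⟨ε, hε, hball⟩ := Metric.eventually_nhds_iff_ball.mp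
      (hzero.and (hf.eventually_analyticAt.and hf.deriv.eventually_analyticAt))
    set c := deriv f s₀ with hc
    have hs₀ := Metric.mem_ball_self (x := s₀) hε
    have hconn := (convex_ball s₀ ε).isPreconnected
    have hf' : ∀ s ∈ Metric.ball s₀ ε, deriv f s = c := fun s hs =>
      Metric.isOpen_ball.is_const_of_deriv_eq_zero hconn
        (fun s hs => (hball s hs).2.2.differentiableAt.differentiableWithinAt)
        (fun s hs => (hball s hs).1) hs hs₀
    have hfs : ∀ s ∈ Metric.ball s₀ ε, f s = f s₀ + c * (s - s₀) := by
      intro s hs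
      have h1 : ∀ s ∈ Metric.ball s₀ ε, HasDerivAt (fun s => f s - c * s) 0 s := fun s hs => by
        simpa [hf' s hs] using
          (hball s hs).2.1.differentiableAt.hasDerivAt.fun_sub ((hasDerivAt_id' s).const_mul c)
      have h2 := Metric.isOpen_ball.is_const_of_deriv_eq_zero hconn
        (fun s hs => (h1 s hs).differentiableAt.differentiableWithinAt)
        (fun s hs => (h1 s hs).deriv) hs hs₀
      linear_combination h2
    refine ⟨{x | x i + x j * (c * s₀ - f s₀) - c * x l = 0}, ?_⟩
    filter_upwards [hfu, hfst.eventually hev, hfst.eventually (Metric.ball_mem_nhds s₀ hε)]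
      with q hq hev hqb v hv
    obtain ⟨hD, hE, -⟩ := hev
    rw [hf' _ hqb] at hE
    rw [hq hv.1]
    have hEu := sum_mul_aeval_pderiv hF (affineChart i j q.1 (f q.1))
    have h0 := hv.1
    rw [hq hv.1] at h0
    set D := fun n => aeval (affineChart i j q.1 (f q.1)) (pderiv n F) with hDdef
    change D i ≠ 0 at hD
    change c * D i + D l = 0 at hE
    ext x
    have hEu' : f q.1 * D i + D j + q.1 * D l = 0 := by
      rw [h0, Fin.sum_univ_eq_of_ne hij hil hjl] at hEu
      simpa [affineChart, hij.symm, hil.symm, hjl.symm] using hEu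
    rw [hfs _ hqb] at hEu'
    have key : ∑ n, x n * D n = (x i + x j * (c * s₀ - f s₀) - c * x l) * D i := by
      rw [Fin.sum_univ_eq_of_ne hij hil hjl]
      linear_combination x j * hEu' + (x l - x j * q.1) * hE
    change ∑ n, x n * D n = 0 ↔ _
    rw [key, mul_eq_zero, or_iff_left hD]
    rfl
  · refine ⟨tangentPlane F (affineChart i j s₀ (f s₀)), ?_⟩
    filter_upwards [hfu, hfst.eventually hev, hfst.eventually (eventually_nhdsWithin_iff.mp hne)]
      with q hq hev hqne v hv
    have hq2 := hq hv.1
    have hq1 : q.1 = s₀ := by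
      by_contra h
      exact hqne h (hev.2.2 v (hq2 ▸ hv))
    rw [hq2, hq1]

theorem finite_tangentPlane_of_isFlex {F : MvPolynomial (Fin 3) ℤ} {k : ℕ}
    (hF : F.IsHomogeneous k)
    (hns : ∀ x : Fin 3 → ℂ, x ≠ 0 → ∃ i, aeval x (pderiv i F) ≠ 0) :
    {T | ∃ p v, p ≠ 0 ∧ IsFlex F p v ∧ tangentPlane F p = T}.Finite := by
  have hcont : Continuous fun p : Fin 3 → ℂ => aeval p F := by
    rw [← continuousOn_univ]
    exact (AnalyticOnNhd.aeval_mvPolynomial (𝕜 := ℂ) (f := id)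
      (fun n => (ContinuousLinearMap.proj (R := ℂ) (φ := fun _ : Fin 3 => ℂ) n).analyticOnNhd _)
      F).continuousOn
  have hK : IsCompact {p : Fin 3 → ℂ | ‖p‖ = 1 ∧ aeval p F = 0} := by
    have h : {p : Fin 3 → ℂ | ‖p‖ = 1 ∧ aeval p F = 0} =
        Metric.sphere 0 1 ∩ (fun p => aeval p F) ⁻¹' {0} := by
      ext p
      simp
    rw [h]
    exact (isCompact_sphere _ _).inter_right (isClosed_singleton.preimage hcont)
  suffices h : {T | ∃ p ∈ {p : Fin 3 → ℂ | ‖p‖ = 1 ∧ aeval p F = 0}, ∃ v,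
      IsFlex F p v ∧ tangentPlane F p = T}.Finite by
    refine h.subset ?_
    rintro T ⟨p, v, hp, hv, rfl⟩
    have hp' : (‖p‖⁻¹ : ℂ) ≠ 0 := by simpa using hp
    have hv' := hv.smul hF hp'
    refine ⟨(‖p‖⁻¹ : ℂ) • p, ⟨?_, hv'.1⟩, v, hv', tangentPlane_smul hF hp' p⟩
    rw [norm_smul]
    simp [hp]
  refine hK.induction_on (p := fun s => {T | ∃ p ∈ s, ∃ v, IsFlex F p v ∧
    tangentPlane F p = T}.Finite) (by simp) ?_ ?_ ?_
  · intro s t hst ht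
    refine ht.subset ?_
    rintro T ⟨p, hp, h⟩
    exact ⟨p, hst hp, h⟩
  · intro s t hs ht
    refine (hs.union ht).subset ?_
    rintro T ⟨p, hp | hp, h⟩
    · exact Or.inl ⟨p, hp, h⟩
    · exact Or.inr ⟨p, hp, h⟩
  · rintro p ⟨hp1, hp0⟩
    have hpne : p ≠ 0 := by
      rintro rfl
      simp at hp1
    obtain ⟨i, hi⟩ := hns p hpne
    obtain ⟨j, hij, hpj⟩ : ∃ j, i ≠ j ∧ p j ≠ 0 := by
      by_contra! h
      have hEu := sum_mul_aeval_pderiv hF p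
      rw [hp0, mul_zero, Finset.sum_eq_single i (fun n _ hn => by rw [h n hn.symm, zero_mul])
        (by simp)] at hEu
      refine hpne (funext fun n => ?_)
      by_cases hn : i = n
      · subst hn
        exact (mul_eq_zero.mp hEu).resolve_right hi
      · exact h n hn
    obtain ⟨l, hil, hjl⟩ : ∃ l, i ≠ l ∧ j ≠ l := by
      clear * -
      revert i j
      decide
    have hchart : ∀ q : Fin 3 → ℂ, q j ≠ 0 →
        affineChart i j (q l / q j) (q i / q j) = (q j)⁻¹ • q := by
      intro q hq
      have hn : ∀ n, n = i ∨ n = j ∨ n = l := by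
        clear * - hij hil hjl
        revert i j l
        decide
      ext n
      rcases hn n with rfl | rfl | rfl
      · simp [affineChart, div_eq_inv_mul]
      · simp [affineChart, hij.symm, hq]
      · simp [affineChart, hil.symm, hjl.symm, div_eq_inv_mul]
    obtain ⟨T, hT⟩ := exists_eventually_tangentPlane_eq hF hij hil hjl
      (s₀ := p l / p j) (t₀ := p i / p j)
      (by rw [hchart p hpj, aeval_smul_of_isHomogeneous hF, hp0, mul_zero])
      (by
        rw [hchart p hpj, aeval_smul_of_isHomogeneous hF.pderiv]
        exact mul_ne_zero (pow_ne_zero _ (inv_ne_zero hpj)) hi)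
    have hπ : Tendsto (fun q : Fin 3 → ℂ => (q l / q j, q i / q j)) (𝓝 p)
        (𝓝 (p l / p j, p i / p j)) := by
      have h : ∀ n, Tendsto (fun q : Fin 3 → ℂ => q n) (𝓝 p) (𝓝 (p n)) := fun n =>
        (continuous_apply n).tendsto p
      exact ((h l).div (h j) hpj).prodMk_nhds ((h i).div (h j) hpj)
    have hev : ∀ᶠ q in 𝓝 p, q j ≠ 0 ∧ ∀ v, IsFlex F q v → tangentPlane F q = T := by
      filter_upwards [hπ.eventually hT, (continuous_apply j).continuousAt.eventually_ne hpj]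
        with q hq hqj
      refine ⟨hqj, fun v hv => ?_⟩
      rw [hchart q hqj] at hq
      rw [← tangentPlane_smul hF (inv_ne_zero hqj) q]
      exact hq v (hv.smul hF (inv_ne_zero hqj))
    refine ⟨_, mem_nhdsWithin_of_mem_nhds hev, (Set.finite_singleton T).subset ?_⟩
    rintro _ ⟨q, ⟨-, hq⟩, v, hv, rfl⟩
    exact hq v hv

end InflectionTangents

section Counting

/-- The plane `T` is parametrized by its `j`-th and `l`-th coordinates, `q` and `w` being the points
whose `(j, l)` coordinates are `(0, 1)` and `(1, 0)`. -/
structure IsPlaneChart (T : Set (Fin 3 → ℂ)) (j l : Fin 3) (q w : Fin 3 → ℂ) : Prop where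
  base_fst : q j = 0
  base_snd : q l = 1
  dir_fst : w j = 1
  dir_snd : w l = 0
  eq_smul_add : ∀ x ∈ T, x = x l • q + x j • w

theorem exists_isPlaneChart (D : Fin 3 → ℂ) {i j l : Fin 3} (hij : i ≠ j) (hil : i ≠ l)
    (hjl : j ≠ l) (hD : D i ≠ 0) : ∃ q w, IsPlaneChart {x | ∑ n, x n * D n = 0} j l q w := by
  refine ⟨fun n => if n = i then -D l / D i else if n = j then 0 else 1,
    fun n => if n = i then -D j / D i else if n = j then 1 else 0, by simp [hij.symm],
    by simp [hil.symm, hjl.symm], by simp [hij.symm], by simp [hil.symm, hjl.symm], ?_⟩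
  intro x hx
  rw [Set.mem_ofPred_eq, Fin.sum_univ_eq_of_ne hij hil hjl] at hx
  have hn : ∀ n, n = i ∨ n = j ∨ n = l := by
    clear * - hij hil hjl
    revert i j l
    decide
  ext n
  rcases hn n with rfl | rfl | rfl
  · simp
    field_simp
    linear_combination hx
  · simp [hij.symm]
  · simp [hil.symm, hjl.symm]

variable {T : Set (Fin 3 → ℂ)} {j l : Fin 3} {q w : Fin 3 → ℂ}
  {F : MvPolynomial (Fin 3) ℤ} {k : ℕ}

theorem IsPlaneChart.eq_smul (h : IsPlaneChart T j l q w) {x : Fin 3 → ℂ} (hx : x ∈ T)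
    (hl : x l ≠ 0) : x = x l • (q + (x j / x l) • w) := by
  rw [smul_add, smul_smul, mul_div_cancel₀ _ hl]
  exact h.eq_smul_add x hx

theorem IsPlaneChart.aeval_eq (h : IsPlaneChart T j l q w) (hF : F.IsHomogeneous k)
    {x : Fin 3 → ℂ} (hx : x ∈ T) (hl : x l ≠ 0) :
    aeval x F = x l ^ k * (lineRestrict F q w).eval (x j / x l) := by
  rw [eval_lineRestrict, ← aeval_smul_of_isHomogeneous hF, ← h.eq_smul hx hl]

theorem IsPlaneChart.rootMultiplicity_le (h : IsPlaneChart T j l q w) {ν : ℕ} (hν : 3 ≤ ν)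
    (hν₁ : ∀ p v : Fin 3 → ℂ, IsInflTangent F p v → contactOrder F p v ≤ ν) (t : ℂ) :
    (lineRestrict F q w).rootMultiplicity t ≤ ν := by
  by_contra! hlt
  have hm : 1 < (lineRestrict F q w).rootMultiplicity t := by omega
  have hne : lineRestrict F q w ≠ 0 := by
    intro h0
    simp [h0] at hm
  have hl : (q + t • w) l = 1 := by simp [h.base_snd, h.dir_snd]
  refine (hν₁ (q + t • w) w ⟨fun h0 => ?_, ?_, fun c hc => ?_, ?_, ?_⟩).not_gt ?_
  · rw [h0] at hl
    exact zero_ne_one hl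
  · rw [← eval_lineRestrict]
    exact (Polynomial.rootMultiplicity_pos hne).mp (by omega)
  · have h1 := congrFun hc l
    rw [Pi.smul_apply, hl, h.dir_snd, smul_eq_mul, mul_one] at h1
    have h2 := congrFun hc j
    rw [← h1, h.dir_fst] at h2
    simp at h2
  · rw [← eval_derivative_lineRestrict]
    exact ((Polynomial.one_lt_rootMultiplicity_iff_isRoot hne).mp hm).2
  · rw [← rootMultiplicity_lineRestrict]
    omega
  · rwa [← rootMultiplicity_lineRestrict]

theorem IsInflTangent.add_smul_mem {k : ℕ} (hF : F.IsHomogeneous k) {p v : Fin 3 → ℂ}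
    (h : IsInflTangent F p v) (a b : ℂ) : a • p + b • v ∈ tangentPlane F p := by
  have h1 : ∑ i, p i * aeval p (pderiv i F) = 0 := by
    rw [sum_mul_aeval_pderiv hF, h.2.1, mul_zero]
  have h2 := h.2.2.2.1
  simp only [tangentPlane, Set.mem_ofPred_eq, Pi.add_apply, Pi.smul_apply, smul_eq_mul, add_mul,
    Finset.sum_add_distrib, mul_assoc, ← Finset.mul_sum, h1, h2, mul_zero, add_zero]

theorem IsPlaneChart.lineRestrict_ne_zero (hF : F.IsHomogeneous k) {p v : Fin 3 → ℂ}
    (h : IsPlaneChart (tangentPlane F p) j l q w) (hpv : IsInflTangent F p v) :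
    lineRestrict F q w ≠ 0 := by
  intro h0
  have hne : lineRestrict F p v ≠ 0 := by
    intro h0
    have h3 : 3 ≤ (lineRestrict F p v).rootMultiplicity 0 := hpv.2.2.2.2
    simp [h0] at h3
  have hmem : ∀ t : ℂ, p + t • v ∈ tangentPlane F p := fun t => by
    simpa using hpv.add_smul_mem hF 1 t
  have hmul : lineRestrict F p v *
      (Polynomial.C (p l) + Polynomial.C (v l) * Polynomial.X) = 0 := by
    refine Polynomial.funext fun t => ?_
    rw [Polynomial.eval_mul, eval_lineRestrict, Polynomial.eval_zero, mul_eq_zero]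
    by_cases hl : (p + t • v) l = 0
    · right
      simpa [mul_comm t] using hl
    · left
      rw [h.aeval_eq hF (hmem t) hl, h0, Polynomial.eval_zero, mul_zero]
  have hlin := (mul_eq_zero.mp hmul).resolve_left hne
  have hpl : p l = 0 := by simpa using congrArg (Polynomial.coeff · 0) hlin
  have hvl : v l = 0 := by simpa using congrArg (Polynomial.coeff · 1) hlin
  have hp : p = p j • w := by
    simpa [hpl] using h.eq_smul_add p (by simpa using hpv.add_smul_mem hF 1 0)
  have hv : v = v j • w := by
    simpa [hvl] using h.eq_smul_add v (by simpa using hpv.add_smul_mem hF 0 1)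
  have hpj : p j ≠ 0 := by
    intro hpj
    rw [hpj, zero_smul] at hp
    exact hpv.1 hp
  refine hpv.2.2.1 (v j / p j) ?_
  rw [hp, smul_smul]
  simp only [Pi.smul_apply, h.dir_fst, smul_eq_mul, mul_one]
  rwa [div_mul_cancel₀ _ hpj]

theorem aeval_intCast {σ : Type*} (F : MvPolynomial σ ℤ) (x : σ → ℤ) :
    aeval (fun i => (x i : ℂ)) F = ((eval x F : ℤ) : ℂ) := by
  have h := MvPolynomial.comp_aeval_apply x (Int.castRingHom ℂ).toIntAlgHom F
  simpa [aeval_eq_eval] using h.symm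

theorem dvd_of_gcd_eq_one_of_mul_eq {x y : Fin 3 → ℤ} {l : Fin 3}
    (hx : Int.gcd (x 0) (Int.gcd (x 1) (x 2)) = 1) (h : ∀ n, x l * y n = y l * x n) :
    x l ∣ y l := by
  obtain ⟨a, b, hab⟩ : IsCoprime (x 0) (Int.gcd (x 1) (x 2)) := Int.isCoprime_iff_gcd_eq_one.mpr hx
  rw [Int.gcd_eq_gcd_ab (x 1) (x 2)] at hab
  set c := (x 1).gcdA (x 2)
  set d := (x 1).gcdB (x 2)
  refine ⟨a * y 0 + b * (y 1 * c + y 2 * d), ?_⟩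
  linear_combination -y l * hab - a * h 0 - b * c * h 1 - b * d * h 2

/-- A primitive triple whose `l`-th coordinate is non-zero is determined up to sign by
the ratios of its coordinates to the `l`-th one. -/
theorem eq_of_gcd_eq_one_of_mul_eq {x y : Fin 3 → ℤ} {l : Fin 3}
    (hx : Int.gcd (x 0) (Int.gcd (x 1) (x 2)) = 1) (hy : Int.gcd (y 0) (Int.gcd (y 1) (y 2)) = 1)
    (hxl : x l ≠ 0) (h : ∀ n, x l * y n = y l * x n) (hs : 0 < x l ↔ 0 < y l) : x = y := by
  have h1 := dvd_of_gcd_eq_one_of_mul_eq hx h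
  have h2 := dvd_of_gcd_eq_one_of_mul_eq hy fun n => (h n).symm
  have h3 := Int.natAbs_eq_natAbs_iff.mp
    (Nat.dvd_antisymm (Int.natAbs_dvd_natAbs.mpr h1) (Int.natAbs_dvd_natAbs.mpr h2))
  have h4 : x l = y l := by omega
  funext n
  have h5 := h n
  rw [← h4] at h5
  exact (mul_left_cancel₀ hxl h5).symm

variable {γ B : ℝ} {x : Fin 3 → ℤ}

/-- The triples counted by `N_γ(F, B)` that lie in the plane `T`, the `l`-th coordinate being at
least the `j`-th one in absolute value. -/
def planeCounted (F : MvPolynomial (Fin 3) ℤ) (T : Set (Fin 3 → ℂ)) (j l : Fin 3) (γ B : ℝ) :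
    Set (Fin 3 → ℤ) :=
  {x | Counted F γ B x ∧ (fun i => (x i : ℂ)) ∈ T ∧ |(x j : ℝ)| ≤ |(x l : ℝ)|}

theorem Counted.abs_le (h : Counted F γ B x) (n : Fin 3) : |(x n : ℝ)| ≤ B := by
  have := h.2.2.2
  simp only [max_le_iff] at this
  fin_cases n
  · exact this.1
  · exact this.2.1
  · exact this.2.2

theorem Counted.exists_lt_abs (h : Counted F γ B x) : ∃ n, B / 2 < |(x n : ℝ)| := by
  have := h.2.2.1
  simp only [lt_max_iff] at this
  rcases this with h | h | h
  exacts [⟨0, h⟩, ⟨1, h⟩, ⟨2, h⟩]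

theorem IsPlaneChart.exists_lt_mul_abs (h : IsPlaneChart T j l q w) :
    ∃ K : ℝ, 0 < K ∧ ∀ (F : MvPolynomial (Fin 3) ℤ) (γ B : ℝ), ∀ x ∈ planeCounted F T j l γ B,
      B < K * |(x l : ℝ)| := by
  refine ⟨2 * (1 + ∑ n, (‖q n‖ + ‖w n‖)), by positivity, ?_⟩
  rintro F γ B x ⟨hx, hxT, hjl⟩
  obtain ⟨n, hn⟩ := hx.exists_lt_abs
  have h1 : (x n : ℂ) = x l * q n + x j * w n := by
    simpa using congrFun (h.eq_smul_add _ hxT) n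
  have h2 : |(x n : ℝ)| ≤ |(x l : ℝ)| * ‖q n‖ + |(x j : ℝ)| * ‖w n‖ := by
    have h3 := norm_add_le ((x l : ℂ) * q n) (x j * w n)
    rwa [← h1, norm_mul, norm_mul, Complex.norm_intCast, Complex.norm_intCast,
      Complex.norm_intCast] at h3
  have h3 : |(x j : ℝ)| * ‖w n‖ ≤ |(x l : ℝ)| * ‖w n‖ := by gcongr
  have h4 : ‖q n‖ + ‖w n‖ ≤ ∑ n, (‖q n‖ + ‖w n‖) :=
    Finset.single_le_sum (f := fun n => ‖q n‖ + ‖w n‖) (fun n _ => by positivity)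
      (Finset.mem_univ n)
  have h5 := mul_le_mul_of_nonneg_left h4 (abs_nonneg (x l : ℝ))
  nlinarith [abs_nonneg (x l : ℝ)]

theorem planeCounted_facts (h : IsPlaneChart T j l q w) (hF : F.IsHomogeneous k) {K : ℝ}
    (hB : 1 ≤ B) (hx : x ∈ planeCounted F T j l γ B) (hK : B < K * |(x l : ℝ)|) :
    x l ≠ 0 ∧ (((x j / x l : ℚ).den : ℝ) ≤ B) ∧ |((x j / x l : ℚ) : ℝ)| ≤ 1 ∧
      (∃ a : ℚ, (lineRestrict F q w).eval ((x j / x l : ℚ) : ℂ) = a) ∧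
      ‖(lineRestrict F q w).eval ((x j / x l : ℚ) : ℂ)‖ ≤ K ^ k * B ^ (-(k - γ)) := by
  have hl : x l ≠ 0 := by
    intro h0
    simp [h0] at hK
    linarith
  obtain ⟨hx, hxT, hjl⟩ := hx
  have hlC : (x l : ℂ) ≠ 0 := by exact_mod_cast hl
  have hlR : 0 < |(x l : ℝ)| := by
    rw [abs_pos]
    exact_mod_cast hl
  have hF := h.aeval_eq hF hxT hlC
  rw [aeval_intCast] at hF
  have hz : ((x j / x l : ℚ) : ℂ) = x j / x l := by push_cast; rfl
  have hval : (lineRestrict F q w).eval ((x j / x l : ℚ) : ℂ) = (eval x F : ℤ) / (x l : ℂ) ^ k := by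
    rw [hz, eq_div_iff (pow_ne_zero _ hlC), hF, mul_comm]
  refine ⟨hl, ?_, ?_, ⟨(eval x F : ℤ) / (x l : ℚ) ^ k, by rw [hval]; push_cast; rfl⟩, ?_⟩
  · refine le_trans ?_ (hx.abs_le l)
    have hd : (((x j / x l : ℚ).den : ℕ) : ℤ) ∣ x l := by
      rw [← Rat.divInt_eq_div]
      exact Rat.den_dvd _ _
    exact_mod_cast Int.le_of_dvd (abs_pos.mpr hl) ((dvd_abs _ _).mpr hd)
  · push_cast
    rw [abs_div]
    exact div_le_one_of_le₀ hjl hlR.le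
  · rw [hval, norm_div, norm_pow, Complex.norm_intCast, Complex.norm_intCast, div_le_iff₀
      (by positivity)]
    have h1 : |((eval x F : ℤ) : ℝ)| ≤ B ^ γ := by exact_mod_cast hx.2.1
    refine h1.trans ?_
    have hB0 : 0 < B := by linarith
    have h2 : B ^ k ≤ (K * |(x l : ℝ)|) ^ k := pow_le_pow_left₀ hB0.le hK.le k
    have h3 : B ^ γ = B ^ (-(k - γ)) * B ^ k := by
      rw [← Real.rpow_natCast, ← Real.rpow_add hB0]
      ring_nf
    rw [h3]
    calc _ ≤ B ^ (-(k - γ)) * (K * |(x l : ℝ)|) ^ k := by gcongr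
      _ = _ := by ring

theorem IsPlaneChart.finite_and_ncard_le (h : IsPlaneChart T j l q w) {S : Set (Fin 3 → ℤ)}
    {Z : Set ℚ} (hZ : Z.Finite) (hS : ∀ x ∈ S, Int.gcd (x 0) (Int.gcd (x 1) (x 2)) = 1 ∧
      (fun i => (x i : ℂ)) ∈ T ∧ x l ≠ 0 ∧ (x j / x l : ℚ) ∈ Z) :
    S.Finite ∧ S.ncard ≤ 2 * Z.ncard := by
  set φ : (Fin 3 → ℤ) → ℚ × Bool := fun x => (x j / x l, decide (0 < x l)) with hφ
  have hmaps : Set.MapsTo φ S (Z ×ˢ Set.univ) := fun x hx => ⟨(hS x hx).2.2.2, Set.mem_univ _⟩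
  have hfin : (Z ×ˢ (Set.univ : Set Bool)).Finite := hZ.prod Set.finite_univ
  have hinj : Set.InjOn φ S := by
    intro x hx y hy hxy
    obtain ⟨hx1, hxT, hxl, -⟩ := hS x hx
    obtain ⟨hy1, hyT, hyl, -⟩ := hS y hy
    rw [hφ, Prod.mk.injEq, decide_eq_decide] at hxy
    refine eq_of_gcd_eq_one_of_mul_eq hx1 hy1 hxl (fun n => ?_) hxy.2
    have hxlC : (x l : ℂ) ≠ 0 := by exact_mod_cast hxl
    have hylC : (y l : ℂ) ≠ 0 := by exact_mod_cast hyl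
    have hz : (x j : ℂ) / x l = y j / y l := by exact_mod_cast congrArg (Rat.cast (K := ℂ)) hxy.1
    have hx' := congrFun (h.eq_smul hxT hxlC) n
    have hy' := congrFun (h.eq_smul hyT hylC) n
    simp only [Pi.smul_apply, smul_eq_mul] at hx' hy'
    have key : (x l : ℂ) * y n = y l * x n := by
      rw [hx', hy', hz]
      ring
    exact_mod_cast key
  refine ⟨hfin.of_injOn hmaps hinj, (Set.ncard_le_ncard_of_injOn φ hmaps hinj hfin).trans ?_⟩
  rw [Set.ncard_prod, Set.ncard_univ, Nat.card_eq_fintype_card, Fintype.card_bool, mul_comm]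

theorem IsPlaneChart.finite_iUnion_planeCounted (h : IsPlaneChart T j l q w)
    (hF : F.IsHomogeneous k) (hne : lineRestrict F q w ≠ 0) {ν : ℕ} (hν0 : ν ≠ 0)
    (hν : ∀ t, (lineRestrict F q w).rootMultiplicity t ≤ ν) (h2 : 2 < (k - γ) / ν) :
    {x | ∃ B : ℝ, 1 ≤ B ∧ x ∈ planeCounted F T j l γ B}.Finite := by
  obtain ⟨K, hK0, hK⟩ := h.exists_lt_mul_abs
  have hτ : 0 < (k : ℝ) - γ := by
    by_contra! h0
    linarith [div_nonpos_of_nonpos_of_nonneg h0 (Nat.cast_nonneg (α := ℝ) ν)]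
  refine (h.finite_and_ncard_le (Polynomial.finite_rat_setOf_norm_eval_le hne hν0 hν
    (W := {z | ∃ a : ℚ, (lineRestrict F q w).eval (z : ℂ) = a}) (fun z hz => hz)
    (pow_nonneg hK0.le k) h2) ?_).1
  rintro x ⟨B, hB, hx⟩
  obtain ⟨hl, hden, h1, hq, hnorm⟩ := planeCounted_facts h hF hB hx (hK F γ B x hx)
  refine ⟨hx.1.1, hx.2.1, hl, hq, h1, hnorm.trans ?_⟩
  have hpos : (0 : ℝ) < (x j / x l : ℚ).den := by exact_mod_cast Rat.den_pos _
  exact mul_le_mul_of_nonneg_left (Real.rpow_le_rpow_of_nonpos hpos hden (by linarith))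
    (pow_nonneg hK0.le k)

theorem exists_ncard_le_of_finite_iUnion (hfin : {x | ∃ B : ℝ, 1 ≤ B ∧
    x ∈ planeCounted F T j l γ B}.Finite) {e : ℝ} (he : e ≤ 0) : ∃ C, 0 ≤ C ∧ ∀ B : ℝ, 1 ≤ B →
      (planeCounted F T j l γ B).Finite ∧ ((planeCounted F T j l γ B).ncard : ℝ) ≤ C * B ^ e := by
  set U := {x | ∃ B : ℝ, 1 ≤ B ∧ x ∈ planeCounted F T j l γ B} with hU
  obtain ⟨M, hM⟩ := (hfin.image fun x => 2 * ∑ n, |(x n : ℝ)|).bddAbove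
  have hM' : 0 < max M 1 := by positivity
  refine ⟨U.ncard * (max M 1) ^ (-e), by positivity, fun B hB => ?_⟩
  have hsub : planeCounted F T j l γ B ⊆ U := fun x hx => ⟨B, hB, hx⟩
  refine ⟨hfin.subset hsub, ?_⟩
  rcases (planeCounted F T j l γ B).eq_empty_or_nonempty with h0 | ⟨x, hx⟩
  · rw [h0, Set.ncard_empty, Nat.cast_zero]
    positivity
  · have hBM : B ≤ max M 1 := by
      obtain ⟨n, hn⟩ := hx.1.exists_lt_abs
      have h1 := Finset.single_le_sum (f := fun n => |(x n : ℝ)|) (fun n _ => abs_nonneg _)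
        (Finset.mem_univ n)
      have h2 := hM ⟨x, hsub hx, rfl⟩
      exact le_max_of_le_left (by simp only at h1 h2; linarith)
    have h1 : ((planeCounted F T j l γ B).ncard : ℝ) ≤ U.ncard := by
      exact_mod_cast Set.ncard_le_ncard hsub hfin
    have h2 : 1 ≤ (max M 1) ^ (-e) * B ^ e := by
      rw [Real.rpow_neg hM'.le, ← div_eq_inv_mul, one_le_div (by positivity)]
      exact Real.rpow_le_rpow_of_nonpos (by linarith) hBM he
    rw [mul_assoc]
    exact h1.trans (le_mul_of_one_le_right (by positivity) h2)

theorem IsPlaneChart.exists_ncard_planeCounted_le (h : IsPlaneChart T j l q w)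
    (hF : F.IsHomogeneous k) (hne : lineRestrict F q w ≠ 0) {ν : ℕ} (hν0 : ν ≠ 0)
    (hν : ∀ t, (lineRestrict F q w).rootMultiplicity t ≤ ν) (hγk : γ < k) :
    ∃ C, 0 ≤ C ∧ ∀ B : ℝ, 1 ≤ B → (planeCounted F T j l γ B).Finite ∧
      ((planeCounted F T j l γ B).ncard : ℝ) ≤ C * B ^ (2 - (k - γ) / ν) := by
  rcases lt_or_ge 2 ((k - γ) / ν) with h2 | h2
  · exact exists_ncard_le_of_finite_iUnion (h.finite_iUnion_planeCounted hF hne hν0 hν h2)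
      (by linarith)
  · obtain ⟨K, hK0, hK⟩ := h.exists_lt_mul_abs
    obtain ⟨C, hC0, hC⟩ := Polynomial.exists_ncard_rat_setOf_norm_eval_le hne hν0 hν
      (pow_nonneg hK0.le k) (sub_pos.mpr hγk)
    refine ⟨4 * C, by positivity, fun B hB => ?_⟩
    obtain ⟨hfin, hcard⟩ := hC B hB
    have hS := h.finite_and_ncard_le (S := planeCounted F T j l γ B) hfin fun x hx => by
      obtain ⟨hl, hden, h1, -, hnorm⟩ := planeCounted_facts h hF hB hx (hK F γ B x hx)
      exact ⟨hx.1.1, hx.2.1, hl, hden, h1, hnorm⟩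
    refine ⟨hS.1, ?_⟩
    have h1 := (Nat.cast_le (α := ℝ)).mpr hS.2
    push_cast at h1
    have h3 : 1 ≤ B ^ (2 - (k - γ) / ν) := Real.one_le_rpow hB (by linarith)
    nlinarith

theorem exists_ncard_tangentPlane_le (hF : F.IsHomogeneous k)
    (hns : ∀ x : Fin 3 → ℂ, x ≠ 0 → ∃ i, aeval x (pderiv i F) ≠ 0) {ν : ℕ} (hν3 : 3 ≤ ν)
    (hν₁ : ∀ p v : Fin 3 → ℂ, IsInflTangent F p v → contactOrder F p v ≤ ν) (hγk : γ < k)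
    {p v : Fin 3 → ℂ} (hpv : IsInflTangent F p v) : ∃ C, 0 ≤ C ∧ ∀ B : ℝ, 1 ≤ B →
      {x | Counted F γ B x ∧ (fun i => (x i : ℂ)) ∈ tangentPlane F p}.Finite ∧
      ({x | Counted F γ B x ∧ (fun i => (x i : ℂ)) ∈ tangentPlane F p}.ncard : ℝ) ≤
        C * B ^ (2 - (k - γ) / ν) := by
  obtain ⟨i, hi⟩ := hns p hpv.1
  obtain ⟨j, l, hij, hil, hjl⟩ : ∃ j l, i ≠ j ∧ i ≠ l ∧ j ≠ l := by
    clear * -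
    revert i
    decide
  have key : ∀ j l, i ≠ j → i ≠ l → j ≠ l → ∃ C, 0 ≤ C ∧ ∀ B : ℝ, 1 ≤ B →
      (planeCounted F (tangentPlane F p) j l γ B).Finite ∧
      ((planeCounted F (tangentPlane F p) j l γ B).ncard : ℝ) ≤
        C * B ^ (2 - (k - γ) / ν) := by
    intro j l hij hil hjl
    obtain ⟨q, w, hqw⟩ := exists_isPlaneChart (fun n => aeval p (pderiv n F)) hij hil hjl hi
    exact IsPlaneChart.exists_ncard_planeCounted_le hqw hF
      (IsPlaneChart.lineRestrict_ne_zero hF hqw hpv) (by omega)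
      (hqw.rootMultiplicity_le hν3 hν₁) hγk
  obtain ⟨C₁, hC₁, h₁⟩ := key j l hij hil hjl
  obtain ⟨C₂, hC₂, h₂⟩ := key l j hil hij hjl.symm
  refine ⟨C₁ + C₂, by positivity, fun B hB => ?_⟩
  have hsub : {x | Counted F γ B x ∧ (fun i => (x i : ℂ)) ∈ tangentPlane F p} ⊆
      planeCounted F (tangentPlane F p) j l γ B ∪ planeCounted F (tangentPlane F p) l j γ B := by
    rintro x ⟨hx, hxT⟩
    rcases le_total |(x j : ℝ)| |(x l : ℝ)| with h | h
    exacts [Or.inl ⟨hx, hxT, h⟩, Or.inr ⟨hx, hxT, h⟩]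
  have hfin := (h₁ B hB).1.union (h₂ B hB).1
  refine ⟨hfin.subset hsub, ?_⟩
  have h3 : ({x | Counted F γ B x ∧ (fun i => (x i : ℂ)) ∈ tangentPlane F p}.ncard : ℝ) ≤
      (planeCounted F (tangentPlane F p) j l γ B).ncard +
      (planeCounted F (tangentPlane F p) l j γ B).ncard := by
    exact_mod_cast (Set.ncard_le_ncard hsub hfin).trans (Set.ncard_union_le _ _)
  rw [add_mul]
  linarith [(h₁ B hB).2, (h₂ B hB).2]

theorem OnInflTangent.exists_mem_tangentPlane (hF : F.IsHomogeneous k) (h : OnInflTangent F x) :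
    ∃ p v, IsInflTangent F p v ∧ (fun i => (x i : ℂ)) ∈ tangentPlane F p := by
  obtain ⟨p, v, hpv, hx⟩ := h
  obtain ⟨a, b, hab⟩ := Submodule.mem_span_pair.mp hx
  exact ⟨p, v, hpv, hab ▸ hpv.add_smul_mem hF a b⟩

end Counting

theorem statement17 (F : MvPolynomial (Fin 3) ℤ) (k : ℕ) (hk : 3 ≤ k)
    (hhom : F.IsHomogeneous k)
    (hns : ∀ x : Fin 3 → ℂ, x ≠ 0 → ∃ i, MvPolynomial.aeval x (MvPolynomial.pderiv i F) ≠ 0)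
    (γ : ℝ) (hγ0 : 0 ≤ γ) (hγk : γ < (k : ℝ))
    (τ : ℝ) (hτ : τ = (k : ℝ) - γ)
    (ν : ℕ)
    (hν₁ : ∀ p v : Fin 3 → ℂ, IsInflTangent F p v → contactOrder F p v ≤ ν)
    (hν₂ : ∃ p v : Fin 3 → ℂ, IsInflTangent F p v ∧ contactOrder F p v = ν) :
    ∃ C : ℝ, 0 < C ∧ ∀ B : ℝ, 1 ≤ B →
      ((Set.ncard {x : Fin 3 → ℤ | Counted F γ B x ∧ OnInflTangent F x} : ℝ)) ≤
        C * B ^ (2 - τ / (ν : ℝ)) := by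
  subst hτ
  have hν3 : 3 ≤ ν := by
    obtain ⟨p, v, hpv, rfl⟩ := hν₂
    exact hpv.2.2.2.2
  have hfin : {T | ∃ p v, IsInflTangent F p v ∧ tangentPlane F p = T}.Finite :=
    (finite_tangentPlane_of_isFlex hhom hns).subset fun T ⟨p, v, hpv, hT⟩ =>
      ⟨p, v, hpv.1, hpv.isFlex, hT⟩
  have hC : ∀ T ∈ {T | ∃ p v, IsInflTangent F p v ∧ tangentPlane F p = T}, ∃ C, 0 ≤ C ∧
      ∀ B : ℝ, 1 ≤ B → {x | Counted F γ B x ∧ (fun i => (x i : ℂ)) ∈ T}.Finite ∧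
        ({x | Counted F γ B x ∧ (fun i => (x i : ℂ)) ∈ T}.ncard : ℝ) ≤
          C * B ^ (2 - (k - γ) / ν) := by
    rintro _ ⟨p, v, hpv, rfl⟩
    exact exists_ncard_tangentPlane_le hhom hns hν3 hν₁ hγk hpv
  choose! C hC0 hC using hC
  refine ⟨∑ T ∈ hfin.toFinset, C T + 1, add_pos_of_nonneg_of_pos
    (Finset.sum_nonneg fun T hT => hC0 T (hfin.mem_toFinset.mp hT)) one_pos, fun B hB => ?_⟩
  have hsub : {x : Fin 3 → ℤ | Counted F γ B x ∧ OnInflTangent F x} ⊆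
      ⋃ T ∈ hfin.toFinset, {x | Counted F γ B x ∧ (fun i => (x i : ℂ)) ∈ T} := by
    rintro x ⟨hx, hxT⟩
    obtain ⟨p, v, hpv, hxp⟩ := hxT.exists_mem_tangentPlane hhom
    exact Set.mem_biUnion (hfin.mem_toFinset.mpr ⟨p, v, hpv, rfl⟩) ⟨hx, hxp⟩
  have hfinU := hfin.toFinset.finite_toSet.biUnion fun T hT =>
    (hC T (hfin.mem_toFinset.mp hT) B hB).1
  have hB0 : (0 : ℝ) ≤ B ^ (2 - (k - γ) / ν) := by positivity
  calc (Set.ncard {x : Fin 3 → ℤ | Counted F γ B x ∧ OnInflTangent F x} : ℝ)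
      ≤ ∑ T ∈ hfin.toFinset,
        ({x | Counted F γ B x ∧ (fun i => (x i : ℂ)) ∈ T}.ncard : ℝ) := by
        exact_mod_cast (Set.ncard_le_ncard hsub hfinU).trans
          (Finset.set_ncard_biUnion_le hfin.toFinset _)
    _ ≤ ∑ T ∈ hfin.toFinset, C T * B ^ (2 - (k - γ) / ν) :=
        Finset.sum_le_sum fun T hT => (hC T (hfin.mem_toFinset.mp hT) B hB).2
    _ ≤ _ := by
        rw [← Finset.sum_mul, add_mul]
        linarith
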